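/- arXiv:2108.08503 — 7 statements merged into one kernel-verified Lean document; each statement's English description precedes it below -/
import Mathlib

section
/- Let A ∈ ℂ^{M×N}, snr > 0, and let γ̂(v) := (1/N)·tr((snr·AᴴA + v⁻¹·I_N)⁻¹) for v > 0, a strictly increasing continuous function whose range is an interval with infimum 0, with inverse γ̂⁻¹. Let v* > 0 lie in the range of γ̂ and define η(v) := 1/v − 1/γ̂⁻¹(v) for v ∈ (0, v*] and ρ* := η(v*). Assume η is continuous and strictly decreasing on (0, v*], that ρ* < snr, and that η(v) → snr as v → 0⁺; let η⁻¹ : [ρ*, snr) → (0, v*] denote the inverse of η. Then ∫_{ρ*}^{snr} η⁻¹(ρ) dρ = log v* + (1/N)·log det((1/v* − ρ*)·I_N + snr·AᴴA), where 1/v* − ρ* = 1/γ̂⁻¹(v*) > 0, so the determinant is a positive real number. -/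
open Matrix

open scoped ComplexOrder in
lemma mat_diag {M N : ℕ} (A : Matrix (Fin M) (Fin N) ℂ) (snr : ℝ) (hsnr : 0 < snr) :
    ∃ d : Fin N → ℝ, (∀ i, 0 ≤ d i) ∧ ∀ s : ℝ, 0 < s →
      ((((s : ℝ) : ℂ) • (1 : Matrix (Fin N) (Fin N) ℂ) + (snr : ℂ) • (Aᴴ * A)).det
        = ((∏ i, (d i + s) : ℝ) : ℂ)) ∧
      ((((snr : ℂ) • (Aᴴ * A) + ((s : ℝ) : ℂ) • (1 : Matrix (Fin N) (Fin N) ℂ))⁻¹).trace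
        = ((∑ i, (d i + s)⁻¹ : ℝ) : ℂ)) := by
  have hp : (Aᴴ * A).PosSemidef := Matrix.posSemidef_conjTranspose_mul_self A
  have hB := hp.isHermitian
  refine ⟨fun i => snr * hB.eigenvalues i, fun i => mul_nonneg hsnr.le (hp.eigenvalues_nonneg i), ?_⟩
  intro s hs
  have hpos : ∀ i, 0 < snr * hB.eigenvalues i + s := fun i => by
    have := mul_nonneg hsnr.le (hp.eigenvalues_nonneg i)
    linarith
  obtain ⟨U, hU1, hU2, hU⟩ : ∃ U : Matrix (Fin N) (Fin N) ℂ, U * star U = 1 ∧ star U * U = 1 ∧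
      Aᴴ * A = U * diagonal (fun i => ((hB.eigenvalues i : ℝ) : ℂ)) * star U := by
    refine ⟨hB.eigenvectorUnitary, by simp, by simp, ?_⟩
    have := hB.spectral_theorem
    rw [Unitary.conjStarAlgAut_apply] at this
    exact this
  have key : (snr : ℂ) • (Aᴴ * A) + ((s : ℝ) : ℂ) • (1 : Matrix (Fin N) (Fin N) ℂ)
      = U * diagonal (fun i => ((snr * hB.eigenvalues i + s : ℝ) : ℂ)) * star U := by
    have h1 : diagonal (fun i => ((snr * hB.eigenvalues i + s : ℝ) : ℂ)) =
      (snr : ℂ) • diagonal (fun i => ((hB.eigenvalues i : ℝ) : ℂ)) + (s:ℂ) • 1 := by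
      ext i j
      by_cases h : i = j
      · subst h; simp
      · simp [h]
    rw [h1, mul_add, add_mul]
    simp only [Matrix.mul_smul, Matrix.smul_mul, mul_one, hU1]
    rw [← hU]
  constructor
  · rw [add_comm, key, det_mul, det_mul, mul_right_comm, ← det_mul, hU1, det_one, one_mul, det_diagonal]
    push_cast; rfl
  · have hinv : (U * diagonal (fun i => ((snr * hB.eigenvalues i + s : ℝ) : ℂ)) * star U)⁻¹
       = U * diagonal (fun i => (((snr * hB.eigenvalues i + s)⁻¹ : ℝ) : ℂ)) * star U := by
      apply Matrix.inv_eq_right_inv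
      have h3 : diagonal (fun i => ((snr * hB.eigenvalues i + s : ℝ) : ℂ)) * diagonal (fun i => (((snr * hB.eigenvalues i + s)⁻¹ : ℝ) : ℂ)) = 1 := by
        rw [diagonal_mul_diagonal, ← diagonal_one]
        congr 1
        ext i
        rw [← Complex.ofReal_mul, mul_inv_cancel₀ (hpos i).ne', Complex.ofReal_one]
      calc _ = U * (diagonal (fun i => ((snr * hB.eigenvalues i + s : ℝ) : ℂ)) * (star U * U) * diagonal (fun i => (((snr * hB.eigenvalues i + s)⁻¹ : ℝ) : ℂ))) * star U := by
              simp only [mul_assoc]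
        _ = 1 := by rw [hU2, mul_one, h3, mul_one, hU1]
    rw [key, hinv, trace_mul_comm, ← mul_assoc, hU2, one_mul, trace_diagonal]
    push_cast; rfl

open MeasureTheory Filter Topology in
lemma scal {N : ℕ} (hN : 0 < N) (d : Fin N → ℝ) (hd : ∀ i, 0 ≤ d i) (g ρ Φ : ℝ → ℝ)
    (hg : ∀ s, g s = (1/(N:ℝ)) * ∑ i, (d i + s)⁻¹) (hρ : ∀ s, ρ s = 1 / g s - s)
    (hΦ : ∀ s, Φ s = Real.log (g s) + (1/(N:ℝ)) * ∑ i, Real.log (d i + s)) :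
    (∀ s > 0, 0 < g s) ∧ Tendsto Φ atTop (𝓝 0) ∧
    ∃ ρ' : ℝ → ℝ, (∀ s > 0, 0 ≤ ρ' s ∧ HasDerivAt ρ (ρ' s) s ∧
      HasDerivAt (fun x => - Φ x) (ρ' s * g s) s) := by
  have hN' : (0:ℝ) < N := by exact_mod_cast hN
  have : Nonempty (Fin N) := ⟨⟨0, hN⟩⟩
  have hpos : ∀ s > 0, ∀ i, 0 < d i + s := fun s hs i => by have := hd i; linarith
  have hgp : ∀ s > 0, 0 < g s := fun s hs => by
    rw [hg]
    have : 0 < ∑ i, (d i + s)⁻¹ := Finset.sum_pos (fun i _ => inv_pos.2 (hpos s hs i)) Finset.univ_nonempty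
    positivity
  refine ⟨hgp, ?_, ?_⟩
  · have hlim : Tendsto (fun s : ℝ => Real.log ((1/(N:ℝ)) * ∑ i, (d i * s⁻¹ + 1)⁻¹)
        + (1/(N:ℝ)) * ∑ i, Real.log (d i * s⁻¹ + 1)) atTop (𝓝 0) := by
      have hi : ∀ i, Tendsto (fun s : ℝ => d i * s⁻¹ + 1) atTop (𝓝 1) := fun i => by
        simpa using (tendsto_inv_atTop_zero.const_mul (d i)).add_const 1
      have h1 : Tendsto (fun s : ℝ => (1/(N:ℝ)) * ∑ i, (d i * s⁻¹ + 1)⁻¹) atTop (𝓝 1) := by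
        have := (tendsto_finsetSum Finset.univ (fun i _ => (hi i).inv₀ one_ne_zero)).const_mul (1/(N:ℝ))
        simpa [hN'.ne'] using this
      have h2 : Tendsto (fun s : ℝ => (1/(N:ℝ)) * ∑ i, Real.log (d i * s⁻¹ + 1)) atTop (𝓝 0) := by
        have := (tendsto_finsetSum Finset.univ (fun i _ => (hi i).log one_ne_zero)).const_mul (1/(N:ℝ))
        simpa using this
      simpa using (h1.log one_ne_zero).add h2
    refine hlim.congr' ?_
    filter_upwards [eventually_gt_atTop 0] with s hs
    have e1 : ∀ i, d i * s⁻¹ + 1 = (d i + s) / s := fun i => by field_simp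
    have e2 : (1/(N:ℝ)) * ∑ i, (d i * s⁻¹ + 1)⁻¹ = s * g s := by
      rw [hg]
      simp_rw [e1, inv_div, div_eq_mul_inv, ← Finset.mul_sum]
      ring
    have e3 : ∀ i, Real.log (d i * s⁻¹ + 1) = Real.log (d i + s) - Real.log s := fun i => by
      rw [e1, Real.log_div (hpos s hs i).ne' hs.ne']
    rw [e2, Real.log_mul hs.ne' (hgp s hs).ne', hΦ]
    simp_rw [e3]
    rw [Finset.sum_sub_distrib]
    simp
    field_simp
    ring
  · refine ⟨fun s => ((1/(N:ℝ)) * ∑ i, ((d i + s)⁻¹)^2) / (g s)^2 - 1, fun s hs => ?_⟩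
    have hgs := hgp s hs
    have hdg : HasDerivAt g (-((1/(N:ℝ)) * ∑ i, ((d i + s)⁻¹)^2)) s := by
      have hi : ∀ i ∈ (Finset.univ : Finset (Fin N)), HasDerivAt (fun s => (d i + s)⁻¹) (-((d i + s)⁻¹)^2) s := fun i _ => by
        have := ((hasDerivAt_id s).const_add (d i)).inv (hpos s hs i).ne'
        exact HasDerivAt.congr_deriv this (by simp [neg_div])
      have := (HasDerivAt.fun_sum hi).const_mul (1/(N:ℝ))
      rw [show g = fun s => (1/(N:ℝ)) * ∑ i, (d i + s)⁻¹ from funext hg]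
      exact HasDerivAt.congr_deriv this (by simp)
    have hdl : HasDerivAt (fun s => (1/(N:ℝ)) * ∑ i, Real.log (d i + s)) (g s) s := by
      have hi : ∀ i ∈ (Finset.univ : Finset (Fin N)), HasDerivAt (fun s => Real.log (d i + s)) ((d i + s)⁻¹) s := fun i _ => by
        have := ((hasDerivAt_id s).const_add (d i)).log (hpos s hs i).ne'
        exact HasDerivAt.congr_deriv this (by simp)
      have := (HasDerivAt.fun_sum hi).const_mul (1/(N:ℝ))
      rw [hg]
      exact this
    refine ⟨?_, ?_, ?_⟩
    · rw [sub_nonneg, one_le_div (by positivity), hg]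
      have := sq_sum_le_card_mul_sum_sq (s := Finset.univ) (f := fun i => (d i + s)⁻¹)
      simp at this
      rw [mul_pow]
      have h5 := mul_le_mul_of_nonneg_left this (show (0:ℝ) ≤ (1/(N:ℝ))^2 by positivity)
      refine h5.trans (le_of_eq ?_)
      simp only [inv_pow]
      field_simp
    · rw [show ρ = fun s => (g s)⁻¹ - s from funext fun s => by rw [hρ, one_div]]
      exact HasDerivAt.congr_deriv ((hdg.inv hgs.ne').sub (hasDerivAt_id s)) (by simp)
    · rw [show Φ = fun s => Real.log (g s) + (1/(N:ℝ)) * ∑ i, Real.log (d i + s) from funext hΦ]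
      refine HasDerivAt.congr_deriv ((hdg.log hgs.ne').add hdl).neg ?_
      beta_reduce
      generalize (∑ i, ((d i + s)⁻¹)^2) = S
      field_simp
      ring

/-- The area term `A_DGE`: for the OAMP state-evolution transfer function
`η(v) = 1/v − 1/γ̂⁻¹(v)` with fixed point `(ρ*, v*)`, one has
`∫_{ρ*}^{snr} η⁻¹(ρ) dρ = log v* + (1/N)·log det((1/v* − ρ*)·I + snr·AᴴA)`. -/
theorem area_DGE_integral_eta_inv
    (M N : ℕ) (hN : 0 < N) (A : Matrix (Fin M) (Fin N) ℂ)
    (snr : ℝ) (hsnr : 0 < snr)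
    (γhat : ℝ → ℝ)
    (hγhat : γhat = fun v : ℝ =>
      (1 / (N : ℝ)) *
        ((((snr : ℂ) • (Aᴴ * A) + ((v⁻¹ : ℝ) : ℂ) • (1 : Matrix (Fin N) (Fin N) ℂ))⁻¹).trace).re)
    (hγ_mono : StrictMonoOn γhat (Set.Ioi (0 : ℝ)))
    (hγ_cont : ContinuousOn γhat (Set.Ioi (0 : ℝ)))
    (vstar : ℝ) (hvstar_pos : 0 < vstar)
    (hvstar_mem : ∃ w > (0 : ℝ), γhat w = vstar)
    (hγ_range : ∀ u ∈ Set.Ioc (0 : ℝ) vstar, ∃ w > (0 : ℝ), γhat w = u)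
    (γinv : ℝ → ℝ)
    (hγinv_left : ∀ w > (0 : ℝ), γinv (γhat w) = w)
    (hγinv_pos : ∀ u ∈ Set.Ioc (0 : ℝ) vstar, 0 < γinv u)
    (η : ℝ → ℝ)
    (hη : ∀ v ∈ Set.Ioc (0 : ℝ) vstar, η v = 1 / v - 1 / γinv v)
    (ρstar : ℝ) (hρstar : ρstar = η vstar)
    (hη_cont : ContinuousOn η (Set.Ioc (0 : ℝ) vstar))
    (hη_anti : StrictAntiOn η (Set.Ioc (0 : ℝ) vstar))
    (hρ_lt : ρstar < snr)
    (hη_lim : Filter.Tendsto η (nhdsWithin 0 (Set.Ioi (0 : ℝ))) (nhds snr))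
    (ηinv : ℝ → ℝ)
    (hηinv_left : ∀ v ∈ Set.Ioc (0 : ℝ) vstar, ηinv (η v) = v)
    (hηinv_right : ∀ ρ ∈ Set.Ico ρstar snr,
      ηinv ρ ∈ Set.Ioc (0 : ℝ) vstar ∧ η (ηinv ρ) = ρ) :
    (1 / vstar - ρstar = 1 / γinv vstar ∧ 0 < 1 / vstar - ρstar)
    ∧ (0 < ((((1 / vstar - ρstar : ℝ) : ℂ) • (1 : Matrix (Fin N) (Fin N) ℂ)
          + (snr : ℂ) • (Aᴴ * A)).det).re
        ∧ ((((1 / vstar - ρstar : ℝ) : ℂ) • (1 : Matrix (Fin N) (Fin N) ℂ)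
          + (snr : ℂ) • (Aᴴ * A)).det).im = 0)
    ∧ (∫ ρ in ρstar..snr, ηinv ρ)
        = Real.log vstar + (1 / (N : ℝ)) *
            Real.log (((((1 / vstar - ρstar : ℝ) : ℂ) • (1 : Matrix (Fin N) (Fin N) ℂ)
              + (snr : ℂ) • (Aᴴ * A)).det).re) := by
  obtain ⟨d, hd, hdm⟩ := mat_diag A snr hsnr
  obtain ⟨g, hg⟩ : ∃ g : ℝ → ℝ, ∀ s, g s = (1/(N:ℝ)) * ∑ i, (d i + s)⁻¹ := ⟨_, fun _ => rfl⟩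
  obtain ⟨r, hr⟩ : ∃ r : ℝ → ℝ, ∀ s, r s = 1 / g s - s := ⟨_, fun _ => rfl⟩
  obtain ⟨Φ, hΦ⟩ : ∃ Φ : ℝ → ℝ, ∀ s, Φ s = Real.log (g s) + (1/(N:ℝ)) * ∑ i, Real.log (d i + s) :=
    ⟨_, fun _ => rfl⟩
  obtain ⟨hgp, hΦlim, r', hr'⟩ := scal hN d hd g r Φ hg hr hΦ
  have hγg : ∀ s > 0, γhat s⁻¹ = g s := fun s hs => by
    rw [hγhat, hg]
    simp only [inv_inv]
    rw [(hdm s hs).2, Complex.ofReal_re]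
  have hγr : ∀ u ∈ Set.Ioc 0 vstar, g (γinv u)⁻¹ = u := fun u hu => by
    obtain ⟨w, hw, rfl⟩ := hγ_range u hu
    rw [hγinv_left w hw, ← hγg _ (inv_pos.2 hw), inv_inv]
  have hvm : vstar ∈ Set.Ioc 0 vstar := ⟨hvstar_pos, le_rfl⟩
  have hinvg : ∀ s > 0, γinv (g s) = s⁻¹ := fun s hs => by
    rw [← hγg s hs, hγinv_left _ (inv_pos.2 hs)]
  have hηg : ∀ s > 0, g s ≤ vstar → η (g s) = r s := fun s hs h => by
    rw [hη _ ⟨hgp s hs, h⟩, hinvg s hs, hr]; simp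
  obtain ⟨s0, hs0⟩ : ∃ s0, s0 = (γinv vstar)⁻¹ := ⟨_, rfl⟩
  have hs0p : 0 < s0 := hs0 ▸ inv_pos.2 (hγinv_pos _ hvm)
  have hgs0 : g s0 = vstar := hs0 ▸ hγr _ hvm
  have hρ0 : ρstar = r s0 := by rw [hρstar, ← hηg s0 hs0p hgs0.le, hgs0]
  have hs0' : 1 / vstar - ρstar = s0 := by rw [hρ0, hr, hgs0]; ring
  have hganti : ∀ a > 0, ∀ b, a < b → g b < g a := fun a ha b hab => by
    have hb : 0 < b := ha.trans hab
    rw [← hγg a ha, ← hγg b hb]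
    exact hγ_mono (inv_pos.2 hb) (inv_pos.2 ha) ((inv_lt_inv₀ hb ha).2 hab)
  have hmem : ∀ s > s0, g s ∈ Set.Ioo 0 vstar := fun s hs =>
    ⟨hgp s (hs0p.trans hs), hgs0 ▸ hganti s0 hs0p s hs⟩
  have hrmono : StrictMonoOn r (Set.Ioi s0) := fun a ha b hb hab => by
    have ha' := hmem a ha
    have hb' := hmem b hb
    have hap := hs0p.trans ha
    have hbp := hs0p.trans hb
    rw [← hηg a hap ha'.2.le, ← hηg b hbp hb'.2.le]
    exact hη_anti ⟨hb'.1, hb'.2.le⟩ ⟨ha'.1, ha'.2.le⟩ (hganti a hap b hab)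
  have hηle : ∀ v ∈ Set.Ioc 0 vstar, η v ≤ snr := fun v hv => by
    refine ge_of_tendsto hη_lim ?_
    filter_upwards [Ioo_mem_nhdsGT hv.1] with x hx
    exact (hη_anti ⟨hx.1, hx.2.le.trans hv.2⟩ hv hx.2).le
  have himg : r '' Set.Ioi s0 = Set.Ioo ρstar snr := by
    ext ρ
    constructor
    · rintro ⟨s, hs, rfl⟩
      have h := hmem s hs
      rw [← hηg s (hs0p.trans hs) h.2.le]
      refine ⟨?_, ?_⟩
      · rw [hρstar]; exact hη_anti ⟨h.1, h.2.le⟩ hvm h.2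
      · have h1 : g s / 2 < g s := half_lt_self h.1
        have h2 : g s / 2 ∈ Set.Ioc 0 vstar := ⟨half_pos h.1, (h1.trans h.2).le⟩
        exact (hη_anti h2 ⟨h.1, h.2.le⟩ h1).trans_le (hηle _ h2)
    · intro h
      obtain ⟨h1, h2⟩ := hηinv_right ρ ⟨h.1.le, h.2⟩
      have hsp : 0 < (γinv (ηinv ρ))⁻¹ := inv_pos.2 (hγinv_pos _ h1)
      have h3 := hγr _ h1
      refine ⟨(γinv (ηinv ρ))⁻¹, ?_, ?_⟩
      · by_contra hcon
        have hle : (γinv (ηinv ρ))⁻¹ ≤ s0 := not_lt.1 hcon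
        have h4 : vstar ≤ ηinv ρ := by
          rcases hle.eq_or_lt with e | e
          · rw [← h3, e, hgs0]
          · have := hganti _ hsp _ e
            rw [h3, hgs0] at this
            exact this.le
        have h5 : ηinv ρ = vstar := le_antisymm h1.2 h4
        rw [h5, ← hρstar] at h2
        exact h.1.ne h2
      · rw [← hηg _ hsp (h3.le.trans h1.2), h3, h2]
  have hdet := (hdm s0 hs0p).1
  have hpp : ∀ i, 0 < d i + s0 := fun i => by have := hd i; linarith
  refine ⟨⟨by rw [hs0', hs0, one_div], hs0' ▸ hs0p⟩, ?_, ?_⟩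
  · rw [hs0', hdet, Complex.ofReal_re, Complex.ofReal_im]
    exact ⟨Finset.prod_pos fun i _ => hpp i, rfl⟩
  · rw [hs0', hdet, Complex.ofReal_re, Real.log_prod (fun i _ => (hpp i).ne'),
      intervalIntegral.integral_of_le hρ_lt.le, MeasureTheory.integral_Ioc_eq_integral_Ioo, ← himg,
      MeasureTheory.integral_image_eq_integral_abs_deriv_smul measurableSet_Ioi
        (fun x hx => (hr' x (hs0p.trans hx)).2.1.hasDerivWithinAt) hrmono.injOn]
    have h6 : ∀ x ∈ Set.Ioi s0, |r' x| • ηinv (r x) = r' x * g x := fun x hx => by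
      have hx0 := hs0p.trans hx
      have h := hmem x hx
      rw [abs_of_nonneg (hr' x hx0).1, smul_eq_mul, ← hηg x hx0 h.2.le, hηinv_left _ ⟨h.1, h.2.le⟩]
    rw [MeasureTheory.setIntegral_congr_fun measurableSet_Ioi h6,
      MeasureTheory.integral_Ioi_of_hasDerivAt_of_nonneg'
        (fun x hx => (hr' x (hs0p.trans_le hx)).2.2)
        (fun x hx => mul_nonneg (hr' x (hs0p.trans hx)).1 (hgp x (hs0p.trans hx)).le) hΦlim.neg,
      hΦ, hgs0]
    ring
end

section
/- Let A ∈ ℂ^{M×N} with A ≠ 0, let snr > 0, and let γ̂(v) := (1/N)·tr((snr·AᴴA + v⁻¹·I_N)⁻¹), a strictly increasing continuous function on (0, ∞) with inverse γ̂⁻¹ defined on its range. Then 0 < γ̂(1) < 1, and the pair (ρ*, v*) := (1/γ̂(1) − 1, γ̂(1)) is the unique pair with ρ* > 0 and v* in the range of γ̂ satisfying the Gaussian-signaling fixed-point system v* = 1/(1 + ρ*) and ρ* = 1/v* − 1/γ̂⁻¹(v*). -/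
open Matrix

open scoped ComplexOrder in
theorem aux_trace (M N : ℕ) (hN : 0 < N) (A : Matrix (Fin M) (Fin N) ℂ) (hA : A ≠ 0)
    (snr : ℝ) (hsnr : 0 < snr) (S : Matrix (Fin N) (Fin N) ℂ)
    (hS : S = (snr : ℂ) • (Aᴴ * A) + 1) :
    0 < (S⁻¹.trace).re ∧ (S⁻¹.trace).re < N := by
  have hpd : S.PosDef := by
    rw [hS]
    exact Matrix.PosDef.posSemidef_add
      ((Matrix.posSemidef_conjTranspose_mul_self A).smul (by exact_mod_cast hsnr.le))
      Matrix.PosDef.one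
  have : Nonempty (Fin N) := ⟨⟨0, hN⟩⟩
  have hu : IsUnit S.det := (Matrix.isUnit_iff_isUnit_det S).1 hpd.isUnit
  have hCpd := hpd.inv
  have hCh : (S⁻¹)ᴴ = S⁻¹ := hCpd.isHermitian
  refine ⟨(Complex.pos_iff.1 hCpd.trace_pos).1, ?_⟩
  set C := S⁻¹ with hC
  have hSC : S * C = 1 := Matrix.mul_nonsing_inv S hu
  have hCS : C * S = 1 := Matrix.nonsing_inv_mul S hu
  set B := (snr : ℂ) • (Aᴴ * A) with hB
  have hBh : Bᴴ = B := by simp [hB]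
  have hBS : B = S - 1 := by rw [hS]; simp
  have key : 1 - C = (B * C)ᴴ * (B * C) + (snr : ℂ) • ((A * C)ᴴ * (A * C)) := by
    have e1 : (snr : ℂ) • ((A * C)ᴴ * (A * C)) = C * B * C := by
      simp [hB, hCh, Matrix.conjTranspose_mul, Matrix.mul_assoc]
    rw [e1, Matrix.conjTranspose_mul, hCh, hBh]
    have e2 : C * B = 1 - C := by rw [hBS, mul_sub, hCS, mul_one]
    have e3 : B * C = 1 - C := by rw [hBS, sub_mul, hSC, one_mul]
    rw [e2, e3]; noncomm_ring
  have hAC : A * C ≠ 0 := fun h => hA (by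
    have : A * C * S = 0 := by rw [h, Matrix.zero_mul]
    rwa [Matrix.mul_assoc, hCS, Matrix.mul_one] at this)
  have t1 := Complex.nonneg_iff.1 (Matrix.posSemidef_conjTranspose_mul_self (B * C)).trace_nonneg
  have t2 := (Matrix.posSemidef_conjTranspose_mul_self (A * C)).trace_nonneg
  have t3 : 0 < ((A * C)ᴴ * (A * C)).trace := lt_of_le_of_ne t2 (fun h =>
    hAC (Matrix.trace_conjTranspose_mul_self_eq_zero_iff.1 h.symm))
  have t4 := (Complex.pos_iff.1 t3).1
  have t := congrArg (fun X => (Matrix.trace X).re) key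
  simp only [Matrix.trace_sub, Matrix.trace_add, Matrix.trace_smul, Matrix.trace_one,
    Fintype.card_fin, Complex.sub_re, Complex.add_re, smul_eq_mul, Complex.re_ofReal_mul,
    Complex.natCast_re] at t
  have := mul_pos hsnr t4
  linarith [t1.1]

/-- For Gaussian signaling, the state-evolution fixed-point system
`v = 1/(1+ρ)`, `ρ = 1/v − 1/γ̂⁻¹(v)` has the unique solution
`(ρ*, v*) = (1/γ̂(1) − 1, γ̂(1))`, and `0 < γ̂(1) < 1`. -/
theorem gaussian_unique_fixed_point
    (M N : ℕ) (hN : 0 < N) (A : Matrix (Fin M) (Fin N) ℂ) (hA : A ≠ 0)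
    (snr : ℝ) (hsnr : 0 < snr)
    (γhat : ℝ → ℝ)
    (hγhat : γhat = fun v : ℝ =>
      (1 / (N : ℝ)) *
        ((((snr : ℂ) • (Aᴴ * A) + ((v⁻¹ : ℝ) : ℂ) • (1 : Matrix (Fin N) (Fin N) ℂ))⁻¹).trace).re)
    (hγ_mono : StrictMonoOn γhat (Set.Ioi (0 : ℝ)))
    (hγ_cont : ContinuousOn γhat (Set.Ioi (0 : ℝ)))
    (γinv : ℝ → ℝ)
    (hγinv_left : ∀ w > (0 : ℝ), γinv (γhat w) = w) :
    0 < γhat 1 ∧ γhat 1 < 1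
    ∧ (0 < 1 / γhat 1 - 1
        ∧ (∃ w > (0 : ℝ), γhat w = γhat 1)
        ∧ γhat 1 = 1 / (1 + (1 / γhat 1 - 1))
        ∧ 1 / γhat 1 - 1 = 1 / γhat 1 - 1 / γinv (γhat 1))
    ∧ (∀ ρ v : ℝ, 0 < ρ → (∃ w > (0 : ℝ), γhat w = v) →
        v = 1 / (1 + ρ) → ρ = 1 / v - 1 / γinv v →
        ρ = 1 / γhat 1 - 1 ∧ v = γhat 1) := by
  obtain ⟨h0, h1⟩ := aux_trace M N hN A hA snr hsnr _ rfl
  have hN' : (0 : ℝ) < N := by exact_mod_cast hN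
  have e : γhat 1 = (1 / (N : ℝ)) *
      ((((snr : ℂ) • (Aᴴ * A) + (1 : Matrix (Fin N) (Fin N) ℂ))⁻¹).trace).re := by
    rw [hγhat]; simp
  have p0 : 0 < γhat 1 := by rw [e]; positivity
  have p1 : γhat 1 < 1 := by
    rw [e, one_div, inv_mul_lt_iff₀ hN']; simpa using h1
  have hi := hγinv_left 1 one_pos
  refine ⟨p0, p1, ⟨?_, ⟨1, one_pos, rfl⟩, ?_, ?_⟩, ?_⟩
  · rw [sub_pos]; exact (one_lt_div p0).2 p1
  · simp
  · rw [hi]; simp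
  · rintro ρ v hρ ⟨w, hw, rfl⟩ h2 h3
    rw [hγinv_left w hw] at h3
    have h4 : 1 / γhat w = 1 + ρ := by rw [h2]; simp
    have h5 : w = 1 := by
      have : 1 / w = 1 := by linarith
      simpa using this
    subst h5
    exact ⟨by linarith, rfl⟩
end

section
/- Let A ∈ ℂ^{M×N} with A ≠ 0, snr > 0, and γ̂(v) := (1/N)·tr((snr·AᴴA + v⁻¹·I_N)⁻¹), strictly increasing and continuous on (0, ∞) with inverse γ̂⁻¹, and set v* := γ̂(1) and ρ* := 1/γ̂(1) − 1. Define η(v) := 1/v − 1/γ̂⁻¹(v) for v ∈ (0, v*]. Assume η is continuous and strictly decreasing on (0, v*], that ρ* < snr, and that η(v) → snr as v → 0⁺; let η⁻¹ : [ρ*, snr) → (0, v*] denote the inverse of η. Then ∫_0^{ρ*} (1/(1 + ρ)) dρ + ∫_{ρ*}^{snr} η⁻¹(ρ) dρ = (1/N)·log det(I_N + snr·AᴴA). -/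
open Matrix

open scoped ComplexOrder in
lemma aux_spec {N : ℕ} (H : Matrix (Fin N) (Fin N) ℂ) (hH : H.PosSemidef) :
    ∃ l : Fin N → ℝ, (∀ i, 0 ≤ l i) ∧ (1 + H).det = ((∏ i, (1 + l i) : ℝ) : ℂ) ∧
      ∀ c : ℝ, 0 < c → ((H + (c : ℂ) • (1 : Matrix (Fin N) (Fin N) ℂ))⁻¹).trace
        = ((∑ i, (l i + c)⁻¹ : ℝ) : ℂ) := by
  obtain ⟨U, V, l, hl, hUV, hVU, hs⟩ : ∃ (U V : Matrix (Fin N) (Fin N) ℂ) (l : Fin N → ℝ), (∀ i, 0 ≤ l i) ∧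
      U * V = 1 ∧ V * U = 1 ∧ H = U * diagonal (fun i => (l i : ℂ)) * V := by
    have h := hH.1.spectral_theorem
    rw [Unitary.conjStarAlgAut_apply] at h
    exact ⟨_, _, hH.1.eigenvalues, hH.eigenvalues_nonneg, by simp, by simp, h⟩
  have key : ∀ c : ℝ, H + (c : ℂ) • (1 : Matrix (Fin N) (Fin N) ℂ)
      = U * diagonal (fun i => ((l i + c : ℝ) : ℂ)) * V := by
    intro c
    have : diagonal (fun i => ((l i + c : ℝ) : ℂ)) = diagonal (fun i => (l i : ℂ)) + (c : ℂ) • (1 : Matrix (Fin N) (Fin N) ℂ) := by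
      ext i j
      by_cases hij : i = j <;> simp [hij, Matrix.one_apply]
    rw [this, mul_add, add_mul, ← hs]
    simp [hUV]
  refine ⟨l, hl, ?_, ?_⟩
  · have h1 := key 1
    rw [Complex.ofReal_one, one_smul] at h1
    rw [add_comm, h1, det_mul, det_mul, mul_right_comm, ← det_mul, hUV, det_diagonal]
    simp [add_comm]
  · intro c hc
    have : (H + (c : ℂ) • (1 : Matrix (Fin N) (Fin N) ℂ))⁻¹
      = U * diagonal (fun i => (((l i + c)⁻¹ : ℝ) : ℂ)) * V := by
      apply Matrix.inv_eq_right_inv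
      rw [key c]
      calc _ = U * (diagonal (fun i => ((l i + c : ℝ) : ℂ)) * (V * U) * diagonal (fun i => (((l i + c)⁻¹ : ℝ) : ℂ))) * V := by
            simp only [mul_assoc]
        _ = 1 := by
          rw [hVU, mul_one, diagonal_mul_diagonal]
          have : (fun i => ((l i + c : ℝ) : ℂ) * (((l i + c)⁻¹ : ℝ) : ℂ)) = fun _ => 1 := by
            ext i
            have : l i + c ≠ 0 := by have := hl i; positivity
            rw [← Complex.ofReal_mul, mul_inv_cancel₀ this]; simp
          rw [this, diagonal_one, mul_one, hUV]
    rw [this, mul_assoc, trace_mul_comm, mul_assoc, hVU, mul_one, trace_diagonal]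
    push_cast; rfl

open Set Filter Topology MeasureTheory in
lemma aux_core (g g' L γ : ℝ → ℝ) (snr : ℝ)
    (hg : ∀ w, 0 ≤ w → 0 < g w) (hgd : ∀ w, 0 ≤ w → HasDerivAt g (g' w) w) (hg0 : g 0 = 1)
    (hLc : ContinuousOn L (Icc 0 1)) (hLd : ∀ w, 0 < w → HasDerivAt L ((1 - g w) / w) w)
    (hL0 : L 0 = 0)
    (hγ : ∀ w, 0 < w → γ w = w * g w)
    (hγ_mono : StrictMonoOn γ (Ioi (0 : ℝ)))
    (γinv : ℝ → ℝ)
    (hγinv_left : ∀ w > (0 : ℝ), γinv (γ w) = w)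
    (η : ℝ → ℝ)
    (hη : ∀ v ∈ Ioc (0 : ℝ) (γ 1), η v = 1 / v - 1 / γinv v)
    (hη_anti : StrictAntiOn η (Ioc (0 : ℝ) (γ 1)))
    (hρ_lt : 1 / γ 1 - 1 < snr)
    (hη_lim : Tendsto η (𝓝[>] 0) (𝓝 snr))
    (ηinv : ℝ → ℝ)
    (hηinv_left : ∀ v ∈ Ioc (0 : ℝ) (γ 1), ηinv (η v) = v)
    (hηinv_right : ∀ ρ ∈ Ico (1 / γ 1 - 1) snr,
      ηinv ρ ∈ Ioc (0 : ℝ) (γ 1) ∧ η (ηinv ρ) = ρ) :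
    (∫ ρ in (0 : ℝ)..(1 / γ 1 - 1), 1 / (1 + ρ)) + (∫ ρ in (1 / γ 1 - 1)..snr, ηinv ρ) = L 1 := by
  have hγpos : ∀ w, 0 < w → 0 < γ w := fun w hw => by
    rw [hγ w hw]; exact mul_pos hw (hg w hw.le)
  have hγmem : ∀ w ∈ Ioc (0 : ℝ) 1, γ w ∈ Ioc (0 : ℝ) (γ 1) := fun w hw =>
    ⟨hγpos w hw.1, hγ_mono.monotoneOn hw.1 (by simp) hw.2⟩
  have hγ1 : 0 < γ 1 := hγpos 1 one_pos
  set r : ℝ → ℝ := fun w => 1 / (w * g w) - 1 / w with hr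
  have hrη : ∀ w ∈ Ioc (0 : ℝ) 1, r w = η (γ w) := fun w hw => by
    rw [hη _ (hγmem w hw), hγinv_left w hw.1, hγ w hw.1]
  have hranti : StrictAntiOn r (Ioc 0 1) := by
    intro a ha b hb hab
    rw [hrη a ha, hrη b hb]
    exact hη_anti (hγmem a ha) (hγmem b hb) (hγ_mono ha.1 hb.1 hab)
  have hr1 : r 1 = 1 / γ 1 - 1 := by simp [hr, hγ 1 one_pos]
  have hle : ∀ v ∈ Ioc (0 : ℝ) (γ 1), η v ≤ snr := by
    intro v hv
    refine ge_of_tendsto hη_lim ?_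
    filter_upwards [Ioo_mem_nhdsGT hv.1] with u hu
    exact (hη_anti ⟨hu.1, hu.2.le.trans hv.2⟩ hv hu.2).le
  have hsurj : ∀ v ∈ Ioc (0 : ℝ) (γ 1), ∃ w ∈ Ioc (0 : ℝ) 1, γ w = v := by
    intro v hv
    have hc : ContinuousOn (fun w => w * g w) (Icc 0 1) := fun w hw =>
      (continuousAt_id.mul (hgd w hw.1).continuousAt).continuousWithinAt
    have := intermediate_value_Icc (zero_le_one) hc
    obtain ⟨w, hw, hwv⟩ := this (show v ∈ _ from ⟨by simpa using hv.1.le, by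
      rw [← hγ 1 one_pos]; exact hv.2⟩)
    have hw0 : 0 < w := by
      rcases hw.1.eq_or_lt with h | h
      · subst h
        simp at hwv
        exact absurd hv.1 (by simp [← hwv])
      · exact h
    exact ⟨w, ⟨hw0, hw.2⟩, by rw [hγ w hw0]; exact hwv⟩
  have himg : r '' Ioc 0 1 = Ico (1 / γ 1 - 1) snr := by
    ext ρ
    constructor
    · rintro ⟨w, hw, rfl⟩
      refine ⟨?_, ?_⟩
      · rw [← hr1]; exact hranti.antitoneOn hw (by simp) hw.2
      · have hw2 : w / 2 ∈ Ioc (0 : ℝ) 1 := ⟨by linarith [hw.1], by linarith [hw.1, hw.2]⟩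
        calc r w < r (w / 2) := hranti hw2 hw (by linarith [hw.1])
          _ ≤ snr := by rw [hrη _ hw2]; exact hle _ (hγmem _ hw2)
    · intro hρ
      obtain ⟨h1, h2⟩ := hηinv_right ρ hρ
      obtain ⟨w, hw, hwv⟩ := hsurj _ h1
      exact ⟨w, hw, by rw [hrη w hw, hwv, h2]⟩
  set r' : ℝ → ℝ := fun w => -(g w + w * g' w) / (w * g w) ^ 2 + 1 / w ^ 2 with hr'
  have hrd : ∀ w, 0 < w → HasDerivAt r (r' w) w := by
    intro w hw
    have h1 : HasDerivAt (fun w => w * g w) (1 * g w + w * g' w) w :=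
      (hasDerivAt_id' w).mul (hgd w hw.le)
    have h2 := (h1.inv (mul_pos hw (hg w hw.le)).ne').sub (hasDerivAt_inv hw.ne')
    have h3 : r = (fun w => w * g w)⁻¹ - fun w => w⁻¹ := by
      ext x; simp [hr]
    rw [h3]
    refine h2.congr_deriv ?_
    change _ = -(g w + w * g' w) / (w * g w) ^ 2 + 1 / w ^ 2
    ring
  have hr'np : ∀ w ∈ Ioo (0 : ℝ) 1, r' w ≤ 0 := by
    intro w hw
    have h1 : HasDerivWithinAt r (r' w) (Ioc 0 1) w := (hrd w hw.1).hasDerivWithinAt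
    have h2 := h1.derivWithin ((uniqueDiffOn_Ioc 0 1) w ⟨hw.1, hw.2.le⟩)
    rw [← h2]
    exact hranti.antitoneOn.derivWithin_nonpos
  have hsub := integral_image_eq_integral_deriv_smul_of_antitoneOn (s := Ioc (0 : ℝ) 1) (f := r)
    (f' := r') measurableSet_Ioc (fun x hx => (hrd x hx.1).hasDerivWithinAt) hranti.antitoneOn ηinv
  set F : ℝ → ℝ := fun w => Real.log (g w) + L w with hF
  have hFc : ContinuousOn F (Icc 0 1) := by
    refine ContinuousOn.add (fun w hw => ?_) hLc
    exact ((hgd w hw.1).continuousAt.log (hg w hw.1).ne').continuousWithinAt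
  have hFd : ∀ w ∈ Ioo (0 : ℝ) 1, HasDerivAt F (-r' w * (w * g w)) w := by
    intro w hw
    have h := ((hgd w hw.1.le).log (hg w hw.1.le).ne').add (hLd w hw.1)
    refine h.congr_deriv ?_
    have := hw.1.ne'
    have := (hg w hw.1.le).ne'
    change _ = -(-(g w + w * g' w) / (w * g w) ^ 2 + 1 / w ^ 2) * (w * g w)
    field_simp
    ring
  have hFpos : ∀ w ∈ Ioo (0 : ℝ) 1, 0 ≤ -r' w * (w * g w) := fun w hw =>
    mul_nonneg (by linarith [hr'np w hw]) (mul_pos hw.1 (hg w hw.1.le)).le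
  have hint : IntervalIntegrable (fun w => -r' w * (w * g w)) volume 0 1 := by
    rw [intervalIntegrable_iff_integrableOn_Ioc_of_le zero_le_one]
    exact intervalIntegral.integrableOn_deriv_of_nonneg hFc hFd hFpos
  have hftc := intervalIntegral.integral_eq_sub_of_hasDerivAt_of_le zero_le_one hFc hFd hint
  have hI2 : (∫ ρ in (1 / γ 1 - 1)..snr, ηinv ρ) = F 1 - F 0 := by
    rw [intervalIntegral.integral_of_le hρ_lt.le, ← integral_Ico_eq_integral_Ioc, ← himg, hsub,
      ← hftc, intervalIntegral.integral_of_le zero_le_one]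
    refine setIntegral_congr_fun measurableSet_Ioc (fun w hw => ?_)
    simp only [smul_eq_mul]
    rw [hrη w hw, hηinv_left _ (hγmem w hw), hγ w hw.1]
  have hI1 : (∫ ρ in (0 : ℝ)..(1 / γ 1 - 1), 1 / (1 + ρ)) = - Real.log (γ 1) := by
    rw [intervalIntegral.integral_comp_add_left (fun x => 1 / x) 1]
    rw [show (1 : ℝ) + (1 / γ 1 - 1) = (γ 1)⁻¹ by ring, add_zero,
      integral_one_div_of_pos one_pos (inv_pos.2 hγ1)]
    simp
  rw [hI1, hI2]
  simp [hF, hg0, hL0, hγ 1 one_pos]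


open scoped ComplexOrder in
lemma aux_psd {M N : ℕ} (A : Matrix (Fin M) (Fin N) ℂ) (s : ℝ) (hs : 0 ≤ s) :
    ((s : ℂ) • (Aᴴ * A)).PosSemidef :=
  (posSemidef_conjTranspose_mul_self A).smul (by exact_mod_cast hs)

/-- For Gaussian signaling, the area `A_ADGO` equals the Gaussian
capacity: `∫_0^{ρ*} dρ/(1+ρ) + ∫_{ρ*}^{snr} η⁻¹(ρ) dρ = (1/N)·log det(I + snr·AᴴA)`,
where `(ρ*, v*) = (1/γ̂(1) − 1, γ̂(1))`. -/
theorem gaussian_area_eq_capacity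
    (M N : ℕ) (hN : 0 < N) (A : Matrix (Fin M) (Fin N) ℂ) (hA : A ≠ 0)
    (snr : ℝ) (hsnr : 0 < snr)
    (γhat : ℝ → ℝ)
    (hγhat : γhat = fun v : ℝ =>
      (1 / (N : ℝ)) *
        ((((snr : ℂ) • (Aᴴ * A) + ((v⁻¹ : ℝ) : ℂ) • (1 : Matrix (Fin N) (Fin N) ℂ))⁻¹).trace).re)
    (hγ_mono : StrictMonoOn γhat (Set.Ioi (0 : ℝ)))
    (hγ_cont : ContinuousOn γhat (Set.Ioi (0 : ℝ)))
    (γinv : ℝ → ℝ)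
    (hγinv_left : ∀ w > (0 : ℝ), γinv (γhat w) = w)
    (vstar ρstar : ℝ)
    (hvstar : vstar = γhat 1) (hρstar : ρstar = 1 / γhat 1 - 1)
    (η : ℝ → ℝ)
    (hη : ∀ v ∈ Set.Ioc (0 : ℝ) vstar, η v = 1 / v - 1 / γinv v)
    (hη_cont : ContinuousOn η (Set.Ioc (0 : ℝ) vstar))
    (hη_anti : StrictAntiOn η (Set.Ioc (0 : ℝ) vstar))
    (hρ_lt : ρstar < snr)
    (hη_lim : Filter.Tendsto η (nhdsWithin 0 (Set.Ioi (0 : ℝ))) (nhds snr))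
    (ηinv : ℝ → ℝ)
    (hηinv_left : ∀ v ∈ Set.Ioc (0 : ℝ) vstar, ηinv (η v) = v)
    (hηinv_right : ∀ ρ ∈ Set.Ico ρstar snr,
      ηinv ρ ∈ Set.Ioc (0 : ℝ) vstar ∧ η (ηinv ρ) = ρ) :
    (∫ ρ in (0 : ℝ)..ρstar, 1 / (1 + ρ)) + (∫ ρ in ρstar..snr, ηinv ρ)
      = (1 / (N : ℝ)) *
          Real.log ((((1 : Matrix (Fin N) (Fin N) ℂ)
            + (snr : ℂ) • (Aᴴ * A)).det).re) := by
  have hNR : (N : ℝ) ≠ 0 := by positivity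
  obtain ⟨l, hl, hdet, htr⟩ := aux_spec _ (aux_psd A snr hsnr.le)
  subst hvstar hρstar
  have hp : ∀ w : ℝ, 0 ≤ w → ∀ i, 0 < 1 + w * l i := fun w hw i => by
    have := mul_nonneg hw (hl i)
    linarith
  rw [hdet, Complex.ofReal_re, Real.log_prod (fun i _ => by have := hl i; positivity)]
  have hsum1 : (1 / (N : ℝ)) * ∑ _i : Fin N, (1 : ℝ) = 1 := by simp [hNR]
  have := aux_core (fun w => (1 / (N : ℝ)) * ∑ i, (1 + w * l i)⁻¹)
    (fun w => (1 / (N : ℝ)) * ∑ i, (-(l i) / (1 + w * l i) ^ 2))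
    (fun w => (1 / (N : ℝ)) * ∑ i, Real.log (1 + w * l i)) γhat snr ?_ ?_ ?_ ?_ ?_ ?_ ?_
    hγ_mono γinv hγinv_left η hη hη_anti hρ_lt hη_lim ηinv hηinv_left hηinv_right
  · simpa using this
  · intro w hw
    have : Nonempty (Fin N) := ⟨⟨0, hN⟩⟩
    have : 0 < ∑ i, (1 + w * l i)⁻¹ :=
      Finset.sum_pos (fun i _ => inv_pos.2 (hp w hw i)) Finset.univ_nonempty
    positivity
  · intro w hw
    refine HasDerivAt.const_mul _ (HasDerivAt.fun_sum fun i _ => ?_)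
    have h := ((hasDerivAt_id' w).mul_const (l i)).const_add 1
    simpa using h.fun_inv (hp w hw i).ne'
  · simp [hNR]
  · refine ContinuousOn.mul continuousOn_const (continuousOn_finsetSum _ fun i _ => ?_)
    refine ContinuousOn.log (by fun_prop) (fun w hw => (hp w hw.1 i).ne')
  · intro w hw
    have h : HasDerivAt (fun w => (1 / (N : ℝ)) * ∑ i, Real.log (1 + w * l i))
        ((1 / (N : ℝ)) * ∑ i, l i / (1 + w * l i)) w := by
      refine HasDerivAt.const_mul _ (HasDerivAt.fun_sum fun i _ => ?_)
      have h := ((hasDerivAt_id' w).mul_const (l i)).const_add 1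
      simpa using h.log (hp w hw.le i).ne'
    convert h using 1
    rw [div_eq_iff hw.ne']
    nth_rewrite 1 [← hsum1]
    rw [← mul_sub, ← Finset.sum_sub_distrib, mul_assoc, Finset.sum_mul]
    congr 1
    refine Finset.sum_congr rfl fun i _ => ?_
    have := (hp w hw.le i).ne'
    field_simp
    ring
  · simp
  · intro w hw
    rw [hγhat]
    simp only
    rw [htr _ (inv_pos.2 hw), Complex.ofReal_re, mul_left_comm]
    congr 1
    rw [Finset.mul_sum]
    refine Finset.sum_congr rfl fun i _ => ?_
    have := (hp w hw.le i).ne'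
    rw [show l i + w⁻¹ = (1 + w * l i) / w by field_simp; ring, inv_div, div_eq_mul_inv]
end

section
/- The function ρ ↦ 1 − ∫_ℝ (exp(−t²/2)/√(2π))·tanh(ρ − √ρ·t) dt (the MMSE of a binary antipodal input over a Gaussian channel at signal-to-noise ratio ρ) is nonnegative and integrable on (0, ∞), and ∫_0^∞ [1 − ∫_ℝ (exp(−t²/2)/√(2π))·tanh(ρ − √ρ·t) dt] dρ = 2·log 2. -/
open MeasureTheory

open Real Set Filter Topology in
lemma gtop : Tendsto (fun u : ℝ => ∫ t in (0:ℝ)..u, Real.exp (-(1/2) * t ^ 2)) atTop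
    (𝓝 (√(2 * π) / 2)) := by
  have h := intervalIntegral_tendsto_integral_Ioi (0:ℝ)
    (integrable_exp_neg_mul_sq (b := 1/2) (by norm_num)).integrableOn (tendsto_id (α := ℝ) (x := atTop))
  rw [integral_gaussian_Ioi, show π / (1/2) = 2 * π by ring] at h
  exact h

open Real Set Filter Topology in
lemma gbot : Tendsto (fun u : ℝ => ∫ t in (0:ℝ)..u, Real.exp (-(1/2) * t ^ 2)) atBot
    (𝓝 (-(√(2 * π) / 2))) := by
  have h := (gtop.comp tendsto_neg_atBot_atTop).neg
  refine h.congr fun u => ?_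
  have := intervalIntegral.integral_comp_neg (a := 0) (b := u)
    (fun t : ℝ => Real.exp (-(1/2) * t ^ 2))
  simp only [Function.comp]
  simp only [even_two, Even.neg_pow, neg_zero] at this
  rw [this, intervalIntegral.integral_symm, neg_neg]

open Real Set Filter Topology in
lemma gderiv (u : ℝ) : HasDerivAt (fun u : ℝ => ∫ t in (0:ℝ)..u, Real.exp (-(1/2) * t ^ 2))
    (Real.exp (-(1/2) * u ^ 2)) u := by
  have hc : Continuous (fun t : ℝ => Real.exp (-(1/2) * t ^ 2)) := by fun_prop
  exact hc.integral_hasStrictDerivAt 0 u |>.hasDerivAt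

open Real Set Filter Topology in
lemma green0 (a : ℝ) (ha : 0 < a) :
    IntegrableOn (fun r : ℝ => Real.exp (-(r + a ^ 2 / r) / 2) / √r) (Ioi 0) ∧
    ∫ r in Ioi (0:ℝ), Real.exp (-(r + a ^ 2 / r) / 2) / √r = Real.exp (-a) * √(2 * π) := by
  set G : ℝ → ℝ := fun u : ℝ => ∫ t in (0:ℝ)..u, Real.exp (-(1/2) * t ^ 2) with hG
  have hGt : Tendsto G atTop (𝓝 (√(2 * π) / 2)) := gtop
  have hGb : Tendsto G atBot (𝓝 (-(√(2 * π) / 2))) := gbot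
  have hGd : ∀ u, HasDerivAt G (Real.exp (-(1/2) * u ^ 2)) u := gderiv
  set F0 : ℝ → ℝ := fun r => Real.exp (-a) * G (√r - a / √r) + Real.exp a * G (√r + a / √r) with hF0
  set c : ℝ := Real.exp (-a) * (-(√(2 * π) / 2)) + Real.exp a * (√(2 * π) / 2) with hc
  set F : ℝ → ℝ := Function.update F0 0 c with hF
  have hs0 : Tendsto (fun r : ℝ => √r) (𝓝[>] 0) (𝓝[>] 0) := by
    refine tendsto_nhdsWithin_iff.2 ⟨?_, ?_⟩
    · have := (Real.continuous_sqrt.tendsto 0)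
      rw [Real.sqrt_zero] at this
      exact this.mono_left nhdsWithin_le_nhds
    · filter_upwards [self_mem_nhdsWithin] with r hr
      exact Real.sqrt_pos.2 hr
  have hs0' : Tendsto (fun r : ℝ => √r) (𝓝[>] 0) (𝓝 0) := hs0.mono_right nhdsWithin_le_nhds
  have hd0 : Tendsto (fun r : ℝ => a / √r) (𝓝[>] 0) atTop := by
    have := (tendsto_inv_nhdsGT_zero.comp hs0).const_mul_atTop ha
    simpa [div_eq_mul_inv, Function.comp_def] using this
  have hst : Tendsto (fun r : ℝ => √r) atTop atTop := Real.tendsto_sqrt_atTop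
  have hdt : Tendsto (fun r : ℝ => a / √r) atTop (𝓝 0) := hst.const_div_atTop a
  have h1 : Tendsto F0 (𝓝[>] 0) (𝓝 c) := by
    refine ((hGb.comp ?_).const_mul _).add ((hGt.comp ?_).const_mul _)
    · simp only [sub_eq_add_neg]
      exact hs0'.add_atBot (tendsto_neg_atTop_atBot.comp hd0)
    · exact hs0'.add_atTop hd0
  have h2 : Tendsto F0 atTop (𝓝 (Real.exp (-a) * (√(2 * π) / 2) + Real.exp a * (√(2 * π) / 2))) := by
    refine ((hGt.comp ?_).const_mul _).add ((hGt.comp ?_).const_mul _)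
    · simp only [sub_eq_add_neg]
      exact hst.atTop_add hdt.neg
    · exact hst.atTop_add hdt
  have hcont : ContinuousWithinAt F (Ici 0) 0 := by
    rw [hF, continuousWithinAt_update_same]
    simpa using h1
  have hlim : Tendsto F atTop (𝓝 (Real.exp (-a) * (√(2 * π) / 2) + Real.exp a * (√(2 * π) / 2))) := by
    refine h2.congr' ?_
    filter_upwards [eventually_gt_atTop 0] with r hr
    rw [hF, Function.update_of_ne hr.ne']
  have hder : ∀ r ∈ Ioi (0:ℝ), HasDerivAt F (Real.exp (-(r + a ^ 2 / r) / 2) / √r) r := by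
    intro r hr
    have hr : 0 < r := hr
    have hev : F =ᶠ[𝓝 r] F0 := by
      filter_upwards [eventually_ne_nhds hr.ne'] with x hx
      rw [hF, Function.update_of_ne hx]
    refine HasDerivAt.congr_of_eventuallyEq ?_ hev
    have hsp : 0 < √r := Real.sqrt_pos.2 hr
    have hsq : √r ^ 2 = r := Real.sq_sqrt hr.le
    have hds := Real.hasDerivAt_sqrt hr.ne'
    have hdd := (hasDerivAt_const r a).div hds hsp.ne'
    have e1 := ((hGd (√r - a / √r)).comp r (hds.sub hdd)).const_mul (Real.exp (-a))
    have e2 := ((hGd (√r + a / √r)).comp r (hds.add hdd)).const_mul (Real.exp a)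
    refine (e1.add e2).congr_deriv ?_
    have x1 : Real.exp (-(1/2) * (√r - a / √r) ^ 2) = Real.exp a * Real.exp (-(r + a ^ 2 / r) / 2) := by
      rw [← Real.exp_add]; congr 1
      have : (√r - a / √r) ^ 2 = √r ^ 2 - 2 * a + a ^ 2 / √r ^ 2 := by field_simp; ring
      rw [this, hsq]; ring
    have x2 : Real.exp (-(1/2) * (√r + a / √r) ^ 2) = Real.exp (-a) * Real.exp (-(r + a ^ 2 / r) / 2) := by
      rw [← Real.exp_add]; congr 1
      have : (√r + a / √r) ^ 2 = √r ^ 2 + 2 * a + a ^ 2 / √r ^ 2 := by field_simp; ring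
      rw [this, hsq]; ring
    rw [x1, x2, Real.exp_neg]
    have := Real.exp_pos a
    field_simp
    ring
  have hpos : ∀ r ∈ Ioi (0:ℝ), 0 ≤ Real.exp (-(r + a ^ 2 / r) / 2) / √r := fun r _ => by positivity
  refine ⟨integrableOn_Ioi_deriv_of_nonneg hcont hder hpos hlim, ?_⟩
  rw [integral_Ioi_of_hasDerivAt_of_nonneg hcont hder hpos hlim, hF, Function.update_self, hc]
  ring

open Real Set Filter Topology in
lemma green (y : ℝ) (hy : y ≠ 0) :
    IntegrableOn (fun r : ℝ => Real.exp (-(y - r) ^ 2 / (2 * r)) / (√(2 * π) * √r)) (Ioi 0) ∧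
    ∫ r in Ioi (0:ℝ), Real.exp (-(y - r) ^ 2 / (2 * r)) / (√(2 * π) * √r) = Real.exp (y - |y|) := by
  obtain ⟨h1, h2⟩ := green0 |y| (abs_pos.2 hy)
  have hpi : 0 < √(2 * π) := by positivity
  have e : ∀ r ∈ Ioi (0:ℝ), Real.exp y / √(2 * π) * (Real.exp (-(r + |y| ^ 2 / r) / 2) / √r) =
      Real.exp (-(y - r) ^ 2 / (2 * r)) / (√(2 * π) * √r) := by
    intro r hr
    have hr : 0 < r := hr
    rw [div_mul_div_comm, ← Real.exp_add, sq_abs]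
    congr 2
    field_simp
    ring
  constructor
  · exact IntegrableOn.congr_fun (h1.const_mul _) e measurableSet_Ioi
  · rw [← setIntegral_congr_fun measurableSet_Ioi e, integral_const_mul, h2, sub_eq_add_neg,
      Real.exp_add]
    field_simp

lemma one_sub_tanh (y : ℝ) :
    1 - Real.tanh y = 2 * Real.exp (-2 * y) / (1 + Real.exp (-2 * y)) := by
  rw [Real.tanh_eq, show -2 * y = -y + -y by ring, Real.exp_add, Real.exp_neg]
  have := Real.exp_pos y
  field_simp
  ring

lemma tanh_cont : Continuous Real.tanh := by
  have : Real.tanh = fun y => (Real.exp y - Real.exp (-y)) / (Real.exp y + Real.exp (-y)) :=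
    funext Real.tanh_eq
  rw [this]
  refine Continuous.div (by fun_prop) (by fun_prop) fun x => by positivity

open Real Set Filter Topology in
lemma half_area : ∫ y in Ioi (0:ℝ), (1 - Real.tanh y) = Real.log 2 := by
  have hd : ∀ y ∈ Ici (0:ℝ), HasDerivAt (fun y => -Real.log (1 + Real.exp (-2 * y)))
      (1 - Real.tanh y) y := by
    intro y _
    have hp : (1 + Real.exp (-2 * y)) ≠ 0 := by positivity
    have h := ((((hasDerivAt_id y).const_mul (-2)).exp.const_add 1).log hp).neg
    refine h.congr_deriv ?_
    rw [one_sub_tanh]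
    simp only [id]
    ring
  have hl : Tendsto (fun y => -Real.log (1 + Real.exp (-2 * y))) atTop (𝓝 0) := by
    have h1 : Tendsto (fun y : ℝ => Real.exp (-2 * y)) atTop (𝓝 0) :=
      Real.tendsto_exp_atBot.comp (tendsto_id.const_mul_atTop_of_neg (by norm_num))
    have h2 := ((h1.const_add 1).log (by norm_num)).neg
    simpa using h2
  rw [integral_Ioi_of_hasDerivAt_of_nonneg' hd
    (fun y _ => by linarith [Real.tanh_lt_one y]) hl]
  norm_num

lemma even_part (y : ℝ) :
    Real.exp (y - |y|) * (1 - Real.tanh y) = 1 - Real.tanh |y| := by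
  rcases le_total 0 y with h | h
  · simp [abs_of_nonneg h]
  · rw [abs_of_nonpos h, one_sub_tanh, one_sub_tanh, show y - -y = y + y by ring,
      show -2 * y = -y + -y by ring, show -2 * -y = y + y by ring, Real.exp_add, Real.exp_add,
      Real.exp_neg]
    have := Real.exp_pos y
    field_simp
    ring

/-- The BPSK MMSE curve
`φ(ρ) = 1 − ∫ (exp(−t²/2)/√(2π))·tanh(ρ − √ρ·t) dt` is nonnegative and integrable on
`(0, ∞)`, and its total area equals the input entropy: `∫_0^∞ φ(ρ) dρ = 2·log 2`. -/
theorem bpsk_mmse_total_area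
    (φ : ℝ → ℝ)
    (hφ : φ = fun ρ : ℝ =>
      1 - ∫ t : ℝ, (Real.exp (-t ^ 2 / 2) / Real.sqrt (2 * Real.pi))
        * Real.tanh (ρ - Real.sqrt ρ * t)) :
    (∀ ρ : ℝ, 0 < ρ → 0 ≤ φ ρ)
    ∧ IntegrableOn φ (Set.Ioi (0 : ℝ))
    ∧ (∫ ρ in Set.Ioi (0 : ℝ), φ ρ) = 2 * Real.log 2 := by
  have hpi : 0 < Real.sqrt (2 * Real.pi) := by positivity
  set k : ℝ → ℝ → ℝ := fun r y =>
    Real.exp (-(y - r) ^ 2 / (2 * r)) / (Real.sqrt (2 * Real.pi) * Real.sqrt r) *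
      (1 - Real.tanh y) with hk
  have hknn : ∀ r y, 0 ≤ k r y := fun r y =>
    mul_nonneg (by positivity) (by linarith [Real.tanh_lt_one y])
  have hrep : ∀ r ∈ Set.Ioi (0:ℝ), ∫ y, k r y = φ r := by
    intro r hr
    have hr : 0 < r := hr
    have hsp : 0 < Real.sqrt r := Real.sqrt_pos.2 hr
    have hsq : Real.sqrt r ^ 2 = r := Real.sq_sqrt hr.le
    have hgi : Integrable (fun t : ℝ => Real.exp (-t ^ 2 / 2) / Real.sqrt (2 * Real.pi)) := by
      have := (integrable_exp_neg_mul_sq (b := 1/2) (by norm_num)).div_const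
        (Real.sqrt (2 * Real.pi))
      convert this using 4
      ring
    have hg1 : ∫ t : ℝ, Real.exp (-t ^ 2 / 2) / Real.sqrt (2 * Real.pi) = 1 := by
      have := integral_gaussian (1/2)
      rw [integral_div, div_eq_one_iff_eq hpi.ne']
      rw [show Real.pi / (1/2) = 2 * Real.pi by ring] at this
      rw [← this]
      congr 1
      ext t
      congr 1
      ring
    have hti : Integrable (fun t : ℝ => (Real.exp (-t ^ 2 / 2) / Real.sqrt (2 * Real.pi))
        * Real.tanh (r - Real.sqrt r * t)) := by
      refine hgi.mul_bdd (c := 1) ?_ ?_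
      · exact (tanh_cont.comp (by fun_prop)).aestronglyMeasurable
      · exact Filter.Eventually.of_forall fun t => (Real.abs_tanh_lt_one _).le
    rw [hφ]
    simp only
    rw [← hg1, ← integral_sub hgi hti, ← integral_sub_left_eq_self (k r) volume r]
    have hcv := Measure.integral_comp_mul_left (fun u => k r (r - u)) (Real.sqrt r)
    rw [abs_of_pos (inv_pos.2 hsp), smul_eq_mul] at hcv
    have h3 : ∫ u, k r (r - u) = Real.sqrt r * ∫ t, k r (r - Real.sqrt r * t) := by
      rw [hcv]; field_simp
    rw [h3, ← integral_const_mul]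
    congr 1
    ext t
    have : -(r - Real.sqrt r * t - r) ^ 2 / (2 * r) = -t ^ 2 / 2 := by
      have : (r - Real.sqrt r * t - r) ^ 2 = Real.sqrt r ^ 2 * t ^ 2 := by ring
      rw [this, hsq]; field_simp
    simp only [hk]
    rw [this]
    field_simp
  have hae0 : ∀ᵐ y : ℝ, y ≠ 0 := Measure.ae_ne volume 0
  have hinner : ∀ y : ℝ, y ≠ 0 → ∫ r in Set.Ioi (0:ℝ), k r y = 1 - Real.tanh |y| := by
    intro y hy
    simp only [hk]
    rw [integral_mul_const, (green y hy).2, even_part]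
  have htot : ∫ y : ℝ, (1 - Real.tanh |y|) = 2 * Real.log 2 := by
    rw [integral_comp_abs (f := fun y => 1 - Real.tanh y), half_area]
  have hti : Integrable (fun y : ℝ => 1 - Real.tanh |y|) := by
    apply Integrable.of_integral_ne_zero
    rw [htot]
    have := Real.log_pos (by norm_num : (1:ℝ) < 2)
    positivity
  have hmeas : Measurable (Function.uncurry k) := by
    have := tanh_cont.measurable
    simp only [hk, Function.uncurry_def]
    fun_prop
  have hint : Integrable (Function.uncurry k)
      ((volume.restrict (Set.Ioi (0:ℝ))).prod volume) := by
    rw [integrable_prod_iff' hmeas.aestronglyMeasurable]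
    constructor
    · filter_upwards [hae0] with y hy
      exact (green y hy).1.mul_const (1 - Real.tanh y)
    · refine hti.congr ?_
      filter_upwards [hae0] with y hy
      rw [← hinner y hy]
      simp only [Function.uncurry, Real.norm_of_nonneg (hknn _ _)]
  refine ⟨fun r hr => ?_, ?_, ?_⟩
  · rw [← hrep r hr]
    exact integral_nonneg (hknn r)
  · have := hint.integral_prod_left
    exact IntegrableOn.congr_fun this hrep measurableSet_Ioi
  · rw [← setIntegral_congr_fun measurableSet_Ioi hrep, integral_integral_swap hint, ← htot]
    refine integral_congr_ae ?_
    filter_upwards [hae0] with y hy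
    exact hinner y hy
end

section
/- Let A ∈ ℂ^{M×N}, R := AᴴA, snr > 0, and let S(w) := (1/N)·tr((R − w·I_N)⁻¹) for w < 0, which is a strictly increasing continuous function on (−∞, 0); let S⁻¹ denote its inverse, defined on the range of S. Let m > 0 with snr·m in the range of S, and let ρ ∈ ℝ with 1/m − ρ > 0. Then m = (1/N)·tr((snr·AᴴA + (1/m − ρ)·I_N)⁻¹) if and only if ρ = snr·(S⁻¹(snr·m) + 1/(snr·m)); equivalently, the fixed-point equation m = γ̂((1/m − ρ)⁻¹) of OAMP state evolution holds if and only if ρ = snr·ℛ(−snr·m), where ℛ(z) := S⁻¹(−z) − 1/z is the R-transform associated with S. -/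
open Matrix

/-- Consistency of the OAMP state-evolution fixed point with the
R-transform fixed-point equation: with `S` the Stieltjes transform of `R = AᴴA`, for
`m > 0` (with `snr·m` in the range of `S`) and `1/m − ρ > 0`,
`m = (1/N)·tr((snr·AᴴA + (1/m − ρ)·I)⁻¹)` iff `ρ = snr·(S⁻¹(snr·m) + 1/(snr·m))`. -/
theorem fixed_point_iff_r_transform
    (M N : ℕ) (hN : 0 < N) (A : Matrix (Fin M) (Fin N) ℂ)
    (snr : ℝ) (hsnr : 0 < snr)
    (S : ℝ → ℝ)
    (hS : S = fun w : ℝ =>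
      (1 / (N : ℝ)) *
        (((Aᴴ * A - (w : ℂ) • (1 : Matrix (Fin N) (Fin N) ℂ))⁻¹).trace).re)
    (hS_mono : StrictMonoOn S (Set.Iio (0 : ℝ)))
    (hS_cont : ContinuousOn S (Set.Iio (0 : ℝ)))
    (Sinv : ℝ → ℝ)
    (hSinv_left : ∀ w < (0 : ℝ), Sinv (S w) = w)
    (m : ℝ) (hm : 0 < m)
    (hmem : ∃ w < (0 : ℝ), S w = snr * m)
    (ρ : ℝ) (hρ : 0 < 1 / m - ρ) :
    m = (1 / (N : ℝ)) *
        ((((snr : ℂ) • (Aᴴ * A)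
          + ((1 / m - ρ : ℝ) : ℂ) • (1 : Matrix (Fin N) (Fin N) ℂ))⁻¹).trace).re
      ↔ ρ = snr * (Sinv (snr * m) + 1 / (snr * m)) := by
  have hc : (snr : ℂ) ≠ 0 := by exact_mod_cast hsnr.ne'
  have key : ∀ B : Matrix (Fin N) (Fin N) ℂ, ((snr : ℂ) • B)⁻¹ = (snr : ℂ)⁻¹ • B⁻¹ := by
    intro B
    by_cases hB : IsUnit B.det
    · apply Matrix.inv_eq_right_inv
      rw [Matrix.smul_mul, Matrix.mul_smul, Matrix.mul_nonsing_inv _ hB, smul_smul,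
        mul_inv_cancel₀ hc, one_smul]
    · have h2 : ¬ IsUnit ((snr : ℂ) • B).det := by
        rw [isUnit_iff_ne_zero, not_not] at hB ⊢
        rw [Matrix.det_smul, hB, mul_zero]
      rw [Matrix.nonsing_inv_apply_not_isUnit _ hB, Matrix.nonsing_inv_apply_not_isUnit _ h2,
        smul_zero]
  obtain ⟨w, hw, hwS⟩ := hmem
  have hinv : Sinv (snr * m) = w := by rw [← hwS]; exact hSinv_left w hw
  obtain ⟨u, hu⟩ : ∃ u : ℝ, u = -(1 / m - ρ) / snr := ⟨_, rfl⟩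
  have hu0 : u < 0 := by rw [hu]; exact div_neg_of_neg_of_pos (by linarith) hsnr
  have huv : 1 / m - ρ = -(snr * u) := by rw [hu]; field_simp
  have hmat : (snr : ℂ) • (Aᴴ * A) + ((1 / m - ρ : ℝ) : ℂ) • (1 : Matrix (Fin N) (Fin N) ℂ)
      = (snr : ℂ) • (Aᴴ * A - (u : ℂ) • (1 : Matrix (Fin N) (Fin N) ℂ)) := by
    rw [huv, smul_sub, smul_smul, sub_eq_add_neg, ← neg_smul]
    push_cast
    rfl
  have hval : (1 / (N : ℝ)) *
        ((((snr : ℂ) • (Aᴴ * A)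
          + ((1 / m - ρ : ℝ) : ℂ) • (1 : Matrix (Fin N) (Fin N) ℂ))⁻¹).trace).re
      = snr⁻¹ * S u := by
    rw [hmat, key, Matrix.trace_smul, smul_eq_mul, ← Complex.ofReal_inv, Complex.re_ofReal_mul, hS]
    ring
  rw [hval, hinv]
  have e1 : snr * (w + 1 / (snr * m)) = snr * w + 1 / m := by field_simp
  rw [e1]
  constructor
  · intro h
    have h1 : S u = snr * m := by rw [h]; field_simp
    have h2 : u = w := by rw [← hSinv_left u hu0, h1, hinv]
    rw [← h2]; linarith
  · intro h
    have h2 : u = w := mul_left_cancel₀ hsnr.ne' (by linarith)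
    rw [h2, hwS]; field_simp
end

section
/- Let A ∈ ℂ^{M×N}, R := AᴴA, and let S(w) := (1/N)·tr((R − w·I_N)⁻¹) for w < 0, strictly increasing and continuous, with inverse S⁻¹ on its range. Let snr > 0 and v > 0 with snr·v in the range of S, and set ρ := snr·(S⁻¹(snr·v) + 1/(snr·v)). Then 1/v − ρ = −snr·S⁻¹(snr·v) > 0, the function z ↦ S⁻¹(z) + 1/z extends continuously to z = 0 with value (1/N)·tr(R) so the following integral converges, and ∫_0^{snr·v} (S⁻¹(z) + 1/z) dz = ρ·v + log v + (1/N)·log det((1/v − ρ)·I_N + snr·R). -/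
open Matrix MeasureTheory

open scoped ComplexOrder in
lemma spec {N : ℕ} (R : Matrix (Fin N) (Fin N) ℂ) (hR : R.PosSemidef) :
    ∃ (l : Fin N → ℝ) (U V : Matrix (Fin N) (Fin N) ℂ), (∀ i, 0 ≤ l i) ∧ U * V = 1 ∧ V * U = 1 ∧
      R = U * diagonal (fun i => (l i : ℂ)) * V := by
  refine ⟨hR.1.eigenvalues, hR.1.eigenvectorUnitary, star (hR.1.eigenvectorUnitary : Matrix (Fin N) (Fin N) ℂ), hR.eigenvalues_nonneg, ?_, ?_, ?_⟩
  · simp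
  · simp
  · have := hR.1.spectral_theorem
    rw [Unitary.conjStarAlgAut_apply] at this
    exact this

open scoped ComplexOrder in
lemma spec' {M N : ℕ} (A : Matrix (Fin M) (Fin N) ℂ) :
    ∃ (l : Fin N → ℝ) (U V : Matrix (Fin N) (Fin N) ℂ), (∀ i, 0 ≤ l i) ∧ U * V = 1 ∧ V * U = 1 ∧
      Aᴴ * A = U * diagonal (fun i => (l i : ℂ)) * V :=
  spec (Aᴴ * A) (posSemidef_conjTranspose_mul_self A)

lemma comb {N : ℕ} (l : Fin N → ℝ) (U V : Matrix (Fin N) (Fin N) ℂ) (h : U * V = 1) (a s : ℝ) :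
    (a : ℂ) • (1 : Matrix (Fin N) (Fin N) ℂ) + (s : ℂ) • (U * diagonal (fun i => (l i : ℂ)) * V)
      = U * diagonal (fun i => ((a + s * l i : ℝ) : ℂ)) * V := by
  have : diagonal (fun i => ((a + s * l i : ℝ) : ℂ)) =
     (a : ℂ) • (1 : Matrix (Fin N) (Fin N) ℂ) + (s : ℂ) • diagonal (fun i => (l i : ℂ)) := by
    rw [← diagonal_one, ← diagonal_smul, ← diagonal_smul, diagonal_add]
    congr 1; ext i; simp
  rw [this]
  simp [mul_add, add_mul, h]

lemma det_comb {N : ℕ} (d : Fin N → ℝ) (U V : Matrix (Fin N) (Fin N) ℂ) (h : U * V = 1) :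
    ((U * diagonal (fun i => (d i : ℂ)) * V).det).re = ∏ i, d i := by
  have h2 : U.det * V.det = 1 := by rw [← det_mul, h, det_one]
  rw [det_mul, det_mul, mul_right_comm, h2, one_mul, det_diagonal, ← Complex.ofReal_prod, Complex.ofReal_re]

lemma trace_comb {N : ℕ} (d : Fin N → ℝ) (U V : Matrix (Fin N) (Fin N) ℂ) (h : V * U = 1) :
    ((U * diagonal (fun i => (d i : ℂ)) * V).trace).re = ∑ i, d i := by
  rw [trace_mul_comm, ← mul_assoc, h, one_mul, trace_diagonal, ← Complex.ofReal_sum, Complex.ofReal_re]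

lemma inv_comb {N : ℕ} (d : Fin N → ℝ) (hd : ∀ i, d i ≠ 0) (U V : Matrix (Fin N) (Fin N) ℂ)
    (h : U * V = 1) (h' : V * U = 1) :
    (U * diagonal (fun i => (d i : ℂ)) * V)⁻¹ = U * diagonal (fun i => (((d i)⁻¹ : ℝ) : ℂ)) * V := by
  apply inv_eq_right_inv
  calc _ = U * diagonal (fun i => (d i : ℂ)) * (V * U) * diagonal (fun i => (((d i)⁻¹ : ℝ) : ℂ)) * V := by
        simp only [mul_assoc]
    _ = U * (diagonal (fun i => (d i : ℂ)) * diagonal (fun i => (((d i)⁻¹ : ℝ) : ℂ))) * V := by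
        rw [h']; simp only [mul_assoc, mul_one, one_mul]
    _ = 1 := by
        rw [diagonal_mul_diagonal]
        have : (fun i => (d i : ℂ) * (((d i)⁻¹ : ℝ) : ℂ)) = fun _ => 1 := by
          ext i; rw [← Complex.ofReal_mul, mul_inv_cancel₀ (hd i), Complex.ofReal_one]
        rw [this, diagonal_one, mul_one, h]

open Filter Topology in
lemma real_main {N : ℕ} (hN : 0 < N) (l : Fin N → ℝ) (hl : ∀ i, 0 ≤ l i) (S : ℝ → ℝ)
    (hS : ∀ w < 0, S w = 1 / (N : ℝ) * ∑ i, (l i - w)⁻¹)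
    (hmono : StrictMonoOn S (Set.Iio (0 : ℝ)))
    (hcont : ContinuousOn S (Set.Iio (0 : ℝ)))
    (Sinv : ℝ → ℝ) (hleft : ∀ w < (0 : ℝ), Sinv (S w) = w)
    (b : ℝ) (w0 : ℝ) (hw0 : w0 < 0) (hb : S w0 = b) :
    Tendsto (fun z : ℝ => Sinv z + 1 / z) (𝓝[>] 0) (𝓝 ((1 / (N : ℝ)) * ∑ i, l i))
    ∧ IntervalIntegrable (fun z : ℝ => Sinv z + 1 / z) volume 0 b
    ∧ (∫ z in (0 : ℝ)..b, (Sinv z + 1 / z)) =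
      w0 * b + Real.log b + 1 + 1 / (N : ℝ) * ∑ i, Real.log (l i - w0) := by
  have hNR : (0 : ℝ) < N := by exact_mod_cast hN
  haveI : Nonempty (Fin N) := ⟨⟨0, hN⟩⟩
  have hpos : ∀ w < 0, ∀ i, 0 < l i - w := fun w hw i => by linarith [hl i]
  have hSpos : ∀ w < 0, 0 < S w := fun w hw => by
    rw [hS w hw]
    have : 0 < ∑ i, (l i - w)⁻¹ :=
      Finset.sum_pos (fun i _ => inv_pos.2 (hpos w hw i)) Finset.univ_nonempty
    positivity
  have hbpos : 0 < b := hb ▸ hSpos w0 hw0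
  -- t
  have ht : ∀ i, Tendsto (fun w : ℝ => -w / (l i - w)) atBot (𝓝 1) := fun i => by
    have h1 : Tendsto (fun w : ℝ => l i - w) atBot atTop :=
      tendsto_atTop_add_const_left _ _ tendsto_neg_atBot_atTop
    have h2 : Tendsto (fun w : ℝ => 1 - l i * (l i - w)⁻¹) atBot (𝓝 (1 - l i * 0)) :=
      tendsto_const_nhds.sub ((tendsto_inv_atTop_zero.comp h1).const_mul _)
    simp only [mul_zero, sub_zero] at h2
    refine h2.congr' ?_
    filter_upwards [eventually_lt_atBot 0] with w hw
    have := (hpos w hw i).ne'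
    field_simp
    ring
  have hmean : ∀ f : Fin N → ℝ → ℝ, ∀ L : Fin N → ℝ, (∀ i, Tendsto (f i) atBot (𝓝 (L i))) →
      Tendsto (fun w => 1 / (N : ℝ) * ∑ i, f i w) atBot (𝓝 (1 / (N : ℝ) * ∑ i, L i)) :=
    fun f L h => (tendsto_finsetSum _ fun i _ => h i).const_mul _
  have hone : 1 / (N : ℝ) * ∑ _i : Fin N, (1 : ℝ) = 1 := by simp [hNR.ne']
  have hmt := hmean _ _ ht
  rw [hone] at hmt
  have hSt : ∀ w < 0, 1 / (N : ℝ) * ∑ i, -w / (l i - w) = -w * S w := fun w hw => by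
    rw [hS w hw]
    simp only [div_eq_mul_inv, ← Finset.mul_sum]
    ring
  -- S → 0
  have hS0 : Tendsto S atBot (𝓝 0) := by
    have h := hmt.mul (tendsto_inv_atTop_zero.comp tendsto_neg_atBot_atTop)
    rw [mul_zero] at h
    refine h.congr' ?_
    filter_upwards [eventually_lt_atBot 0] with w hw
    rw [hSt w hw]
    simp only [Function.comp]
    have := hw.ne
    field_simp
  -- surjectivity
  have hsurj : ∀ z, 0 < z → z ≤ b → ∃ w < 0, S w = z := fun z hz hzb => by
    obtain ⟨w1, hw1, hw1'⟩ :=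
      ((hS0.eventually (gt_mem_nhds hz)).and (eventually_lt_atBot w0)).exists
    have := intermediate_value_Icc hw1'.le
      (hcont.mono fun x hx => lt_of_le_of_lt hx.2 hw0)
    obtain ⟨w, hw, hwz⟩ := this ⟨hw1.le, hb ▸ hzb⟩
    exact ⟨w, lt_of_le_of_lt hw.2 hw0, hwz⟩
  -- Sinv → -∞
  have hSinv_lim : Tendsto Sinv (𝓝[>] 0) atBot := by
    rw [tendsto_atBot]
    intro C
    have hC : min C (-1) < 0 := lt_of_le_of_lt (min_le_right _ _) (by norm_num)
    have hC' := hSpos _ hC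
    filter_upwards [Ioo_mem_nhdsGT (lt_min hC' hbpos)] with z hz
    obtain ⟨w, hw, rfl⟩ := hsurj z hz.1 (hz.2.le.trans (min_le_right _ _))
    rw [hleft w hw]
    have : S w < S (min C (-1)) := lt_of_lt_of_le hz.2 (min_le_left _ _)
    exact ((hmono.lt_iff_lt hw hC).1 this).le.trans (min_le_left _ _)
  have hSS : ∀ z, 0 < z → z ≤ b → S (Sinv z) = z ∧ Sinv z < 0 := fun z hz hzb => by
    obtain ⟨w, hw, rfl⟩ := hsurj z hz hzb
    rw [hleft w hw]
    exact ⟨rfl, hw⟩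
  have hev : ∀ᶠ z in 𝓝[>] (0 : ℝ), 0 < z ∧ z ≤ b := by
    filter_upwards [Ioo_mem_nhdsGT hbpos] with z hz using ⟨hz.1, hz.2.le⟩
  -- limit of integrand
  have hlim : Tendsto (fun z : ℝ => Sinv z + 1 / z) (𝓝[>] 0) (𝓝 ((1 / (N : ℝ)) * ∑ i, l i)) := by
    have h1 : Tendsto (fun w => w + 1 / S w) atBot (𝓝 ((1 / (N : ℝ)) * ∑ i, l i)) := by
      have h := (hmean _ _ (fun i => (ht i).const_mul (l i))).div hmt one_ne_zero
      simp only [mul_one, div_one] at h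
      refine h.congr' ?_
      filter_upwards [eventually_lt_atBot 0] with w hw
      simp only [Pi.div_apply]
      rw [hSt w hw]
      have h3 : 1 / (N : ℝ) * ∑ i, l i * (-w / (l i - w)) = -w * (1 + w * S w) := by
        have : ∀ i, l i * (-w / (l i - w)) = -w * (1 + w * (l i - w)⁻¹) := fun i => by
          have := (hpos w hw i).ne'
          field_simp
          ring
        simp only [this, ← Finset.mul_sum, Finset.sum_add_distrib]
        rw [hS w hw]
        simp only [Finset.sum_const, Finset.card_univ, Fintype.card_fin, nsmul_eq_mul, mul_one]
        field_simp
      rw [h3]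
      have := hw.ne
      have := (hSpos w hw).ne'
      field_simp
      ring
    refine (h1.comp hSinv_lim).congr' ?_
    filter_upwards [hev] with z hz
    simp only [Function.comp, (hSS z hz.1 hz.2).1]
  -- antiderivative
  set G : ℝ → ℝ := fun w => w * S w + Real.log (S w) + 1 +
    1 / (N : ℝ) * ∑ i, Real.log (l i - w) with hG
  have hG0 : Tendsto G atBot (𝓝 0) := by
    have h := ((hmt.const_sub 1).add (hmt.log one_ne_zero)).sub
      (hmean _ _ (fun i => (ht i).log one_ne_zero))
    simp only [Real.log_one, Finset.sum_const_zero, mul_zero, sub_self, add_zero] at h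
    refine h.congr' ?_
    filter_upwards [eventually_lt_atBot 0] with w hw
    rw [hSt w hw, hG]
    have hw' : 0 < -w := by linarith
    simp only [fun i => Real.log_div hw'.ne' (hpos w hw i).ne', Finset.sum_sub_distrib]
    rw [Real.log_mul hw'.ne' (hSpos w hw).ne']
    simp only [Finset.sum_const, Finset.card_univ, Fintype.card_fin, nsmul_eq_mul]
    field_simp
    ring
  have hSd : ∀ w < 0, HasStrictDerivAt S (1 / (N : ℝ) * ∑ i, ((l i - w) ^ 2)⁻¹) w := fun w hw => by
    have h : HasStrictDerivAt (fun w => 1 / (N : ℝ) * ∑ i, (l i - w)⁻¹)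
        (1 / (N : ℝ) * ∑ i, ((l i - w) ^ 2)⁻¹) w := by
      refine (HasStrictDerivAt.fun_sum fun i _ => ?_).const_mul _
      have h1 : HasStrictDerivAt (fun w => l i - w) (-1) w := (hasStrictDerivAt_id w).const_sub _
      have := (hasStrictDerivAt_inv (hpos w hw i).ne').comp w h1
      refine HasStrictDerivAt.congr_deriv this ?_
      simp
    refine h.congr_of_eventuallyEq ?_
    filter_upwards [Iio_mem_nhds hw] with x hx using (hS x hx).symm
  have hSd0 : ∀ w < 0, 0 < 1 / (N : ℝ) * ∑ i, ((l i - w) ^ 2)⁻¹ := fun w hw => by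
    have : 0 < ∑ i, ((l i - w) ^ 2)⁻¹ :=
      Finset.sum_pos (fun i _ => inv_pos.2 (pow_pos (hpos w hw i) 2)) Finset.univ_nonempty
    positivity
  have hSinvd : ∀ w < 0, HasDerivAt Sinv (1 / (N : ℝ) * ∑ i, ((l i - w) ^ 2)⁻¹)⁻¹ (S w) :=
    fun w hw => by
    refine ((hSd w hw).to_local_left_inverse (hSd0 w hw).ne' ?_).hasDerivAt
    filter_upwards [Iio_mem_nhds hw] with x hx using hleft x hx
  have hGd : ∀ w < 0, HasDerivAt G ((w + 1 / S w) * (1 / (N : ℝ) * ∑ i, ((l i - w) ^ 2)⁻¹)) w :=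
    fun w hw => by
    have h1 := (hSd w hw).hasDerivAt
    have h2 : HasDerivAt (fun w => 1 / (N : ℝ) * ∑ i, Real.log (l i - w))
        (1 / (N : ℝ) * ∑ i, (-1) / (l i - w)) w := by
      refine (HasDerivAt.fun_sum fun i _ => ?_).const_mul _
      exact ((hasDerivAt_id w).const_sub (l i)).log (hpos w hw i).ne'
    have h3 := ((((hasDerivAt_id w).mul h1).add (h1.log (hSpos w hw).ne')).add_const 1).add h2
    refine h3.congr_deriv ?_
    have h4 : 1 / (N : ℝ) * ∑ i, (-1) / (l i - w) = - S w := by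
      rw [hS w hw]
      simp only [div_eq_mul_inv, ← Finset.mul_sum]
      ring
    rw [h4]
    simp only [id]
    ring
  have hFd : ∀ z, 0 < z → z ≤ b → HasDerivAt (fun z => G (Sinv z)) (Sinv z + 1 / z) z :=
    fun z hz hzb => by
    obtain ⟨w, hw, rfl⟩ := hsurj z hz hzb
    have h1 : HasDerivAt G ((w + 1 / S w) * (1 / (N : ℝ) * ∑ i, ((l i - w) ^ 2)⁻¹)) (Sinv (S w)) := by
      rw [hleft w hw]; exact hGd w hw
    refine (h1.comp (S w) (hSinvd w hw)).congr_deriv ?_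
    rw [mul_assoc, mul_inv_cancel₀ (hSd0 w hw).ne', mul_one, hleft w hw]
  have hcontz : ∀ z, 0 < z → z ≤ b → ContinuousAt (fun z : ℝ => Sinv z + 1 / z) z :=
    fun z hz hzb => by
    obtain ⟨w, hw, rfl⟩ := hsurj z hz hzb
    exact (hSinvd w hw).continuousAt.add
      (continuousAt_const.div continuousAt_id hz.ne')
  have hint : IntervalIntegrable (fun z : ℝ => Sinv z + 1 / z) volume 0 b := by
    have hc := continuousOn_Icc_extendFrom_Ioo (f := fun z : ℝ => Sinv z + 1 / z) (a := 0) (b := b)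
      (fun z hz => (hcontz z hz.1 hz.2.le).continuousWithinAt) hlim
      ((hcontz b hbpos le_rfl).tendsto.mono_left nhdsWithin_le_nhds)
    have hi := hc.intervalIntegrable_of_Icc (μ := volume) hbpos.le
    refine (intervalIntegrable_congr ?_).1 hi
    intro z hz
    rw [Set.uIoc_of_le hbpos.le] at hz
    refine extendFrom_eq ?_ ((hcontz z hz.1 hz.2).tendsto.mono_left nhdsWithin_le_nhds)
    rw [closure_Ioo hbpos.ne]
    exact ⟨hz.1.le, hz.2⟩
  refine ⟨hlim, hint, ?_⟩
  rw [intervalIntegral.integral_eq_sub_of_hasDerivAt_of_tendsto hbpos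
    (fun z hz => hFd z hz.1 hz.2.le) hint (hG0.comp hSinv_lim)
    ((hFd b hbpos le_rfl).continuousAt.tendsto.mono_left nhdsWithin_le_nhds)]
  have : Sinv b = w0 := by rw [← hb]; exact hleft w0 hw0
  rw [this, hG]
  simp only [hb, sub_zero]



/-- The R-transform integral (area `A_BDGO`): with `S` the Stieltjes
transform of `R = AᴴA`, `v > 0`, `snr·v` in the range of `S`, and
`ρ := snr·(S⁻¹(snr·v) + 1/(snr·v))`, one has `1/v − ρ = −snr·S⁻¹(snr·v) > 0`, the
integrand `z ↦ S⁻¹(z) + 1/z` extends continuously to `0` with value `(1/N)·tr(R)` (so the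
integral converges), and
`∫_0^{snr·v} (S⁻¹(z) + 1/z) dz = ρ·v + log v + (1/N)·log det((1/v − ρ)·I + snr·R)`. -/
theorem r_transform_integral_eq_log_det
    (M N : ℕ) (hN : 0 < N) (A : Matrix (Fin M) (Fin N) ℂ)
    (snr : ℝ) (hsnr : 0 < snr)
    (S : ℝ → ℝ)
    (hS : S = fun w : ℝ =>
      (1 / (N : ℝ)) *
        (((Aᴴ * A - (w : ℂ) • (1 : Matrix (Fin N) (Fin N) ℂ))⁻¹).trace).re)
    (hS_mono : StrictMonoOn S (Set.Iio (0 : ℝ)))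
    (hS_cont : ContinuousOn S (Set.Iio (0 : ℝ)))
    (Sinv : ℝ → ℝ)
    (hSinv_left : ∀ w < (0 : ℝ), Sinv (S w) = w)
    (v : ℝ) (hv : 0 < v)
    (hmem : ∃ w < (0 : ℝ), S w = snr * v)
    (ρ : ℝ) (hρ : ρ = snr * (Sinv (snr * v) + 1 / (snr * v))) :
    (1 / v - ρ = -(snr * Sinv (snr * v)) ∧ 0 < 1 / v - ρ)
    ∧ Filter.Tendsto (fun z : ℝ => Sinv z + 1 / z) (nhdsWithin 0 (Set.Ioi (0 : ℝ)))
        (nhds ((1 / (N : ℝ)) * ((Aᴴ * A).trace).re))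
    ∧ IntervalIntegrable (fun z : ℝ => Sinv z + 1 / z) volume 0 (snr * v)
    ∧ (∫ z in (0 : ℝ)..(snr * v), (Sinv z + 1 / z))
        = ρ * v + Real.log v + (1 / (N : ℝ)) *
            Real.log (((((1 / v - ρ : ℝ) : ℂ) • (1 : Matrix (Fin N) (Fin N) ℂ)
              + (snr : ℂ) • (Aᴴ * A)).det).re) := by
  obtain ⟨l, U, V, hl, hUV, hVU, hR⟩ := spec' A
  obtain ⟨w0, hw0, hb⟩ := hmem
  have hinv : Sinv (snr * v) = w0 := by rw [← hb]; exact hSinv_left w0 hw0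
  have hS' : ∀ w < 0, S w = 1 / (N : ℝ) * ∑ i, (l i - w)⁻¹ := fun w hw => by
    have hc := comb l U V hUV (-w) 1
    have h1 : Aᴴ * A - (w : ℂ) • (1 : Matrix (Fin N) (Fin N) ℂ) =
        U * diagonal (fun i => ((-w + 1 * l i : ℝ) : ℂ)) * V := by
      rw [← hc, ← hR]
      simp [sub_eq_add_neg, add_comm]
    rw [hS]
    simp only
    rw [h1, inv_comb (fun i => -w + 1 * l i) (fun i => by have := hl i; linarith) U V hUV hVU,
      trace_comb _ U V hVU]
    congr 1
    refine Finset.sum_congr rfl fun i _ => ?_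
    congr 1
    ring
  obtain ⟨h1, h2, h3⟩ := real_main hN l hl S hS' hS_mono hS_cont Sinv hSinv_left _ w0 hw0 hb
  have htr : ((Aᴴ * A).trace).re = ∑ i, l i := by
    rw [hR]; exact trace_comb l U V hVU
  have hρ1 : 1 / v - ρ = -(snr * w0) := by
    rw [hρ, hinv]
    field_simp
    ring
  refine ⟨⟨by rw [hρ1, hinv], ?_⟩, by rw [htr]; exact h1, h2, ?_⟩
  · rw [hρ1]
    nlinarith
  rw [h3, hρ1, hR, comb l U V hUV, det_comb _ U V hUV]
  have hp : ∀ i, 0 < l i - w0 := fun i => by linarith [hl i]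
  have hf : ∀ i, -(snr * w0) + snr * l i = snr * (l i - w0) := fun i => by ring
  simp only [hf]
  rw [Real.log_prod (fun i _ => (mul_pos hsnr (hp i)).ne')]
  simp only [fun i => Real.log_mul hsnr.ne' (hp i).ne', Finset.sum_add_distrib]
  rw [Real.log_mul hsnr.ne' hv.ne']
  simp only [Finset.sum_const, Finset.card_univ, Fintype.card_fin, nsmul_eq_mul]
  have hNR : (N : ℝ) ≠ 0 := by exact_mod_cast hN.ne'
  rw [hρ, hinv]
  field_simp
  ring
end

section
/- Let A ∈ ℂ^{M×N} with A ≠ 0 and snr > 0, and let γ̂(v) := (1/N)·tr((snr·AᴴA + v⁻¹·I_N)⁻¹), a strictly increasing continuous function on (0, ∞) whose range is an interval with infimum 0; let γ̂⁻¹ denote its inverse, defined on that range. Then the OAMP linear-estimator transfer function η(v) := 1/v − 1/γ̂⁻¹(v) satisfies lim_{v → 0⁺} η(v) = snr·(1/N)·tr(AᴴA); in particular, if the sensing matrix is normalized so that (1/N)·tr(AᴴA) = 1, then η(v) → snr as v → 0⁺. -/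
open Matrix

theorem aux_trace_s18 {N : ℕ} (H : Matrix (Fin N) (Fin N) ℂ) (hH : H.IsHermitian)
    (hp : ∀ i, 0 ≤ hH.eigenvalues i) (s c : ℝ) (hs : 0 < s) (hc : 0 < c) :
    (((s : ℂ) • H + (c : ℂ) • (1 : Matrix (Fin N) (Fin N) ℂ))⁻¹).trace
      = ((∑ i, 1 / (s * hH.eigenvalues i + c) : ℝ) : ℂ) := by
  set U : Matrix (Fin N) (Fin N) ℂ := (hH.eigenvectorUnitary : Matrix (Fin N) (Fin N) ℂ) with hU
  have h1 : U * star U = 1 := Unitary.coe_mul_star_self hH.eigenvectorUnitary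
  have h2 : star U * U = 1 := Unitary.coe_star_mul_self hH.eigenvectorUnitary
  have hsp : H = U * diagonal (fun i => (hH.eigenvalues i : ℂ)) * star U := by
    have := hH.spectral_theorem
    rw [Unitary.conjStarAlgAut_apply] at this
    exact this
  have hne : ∀ i, s * hH.eigenvalues i + c ≠ 0 := fun i => by
    have := mul_nonneg hs.le (hp i)
    positivity
  have e : (s : ℂ) • H + (c : ℂ) • (1 : Matrix (Fin N) (Fin N) ℂ)
      = U * diagonal (fun i => ((s * hH.eigenvalues i + c : ℝ) : ℂ)) * star U := by
    have d : diagonal (fun i => ((s * hH.eigenvalues i + c : ℝ) : ℂ))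
        = (s : ℂ) • diagonal (fun i => (hH.eigenvalues i : ℂ))
          + (c : ℂ) • (1 : Matrix (Fin N) (Fin N) ℂ) := by
      ext i j
      by_cases h : i = j
      · subst h; simp
      · simp [h]
    rw [d, mul_add, add_mul, mul_smul_comm, mul_smul_comm, smul_mul_assoc, smul_mul_assoc,
      ← hsp, mul_one, h1]
  have inv : ((s : ℂ) • H + (c : ℂ) • (1 : Matrix (Fin N) (Fin N) ℂ))⁻¹
      = U * diagonal (fun i => ((1 / (s * hH.eigenvalues i + c) : ℝ) : ℂ)) * star U := by
    apply Matrix.inv_eq_right_inv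
    rw [e]
    have d : diagonal (fun i => ((s * hH.eigenvalues i + c : ℝ) : ℂ)) *
        diagonal (fun i => ((1 / (s * hH.eigenvalues i + c) : ℝ) : ℂ)) = 1 := by
      rw [diagonal_mul_diagonal, ← diagonal_one]
      congr 1
      funext i
      rw [← Complex.ofReal_mul, mul_one_div_cancel (hne i), Complex.ofReal_one]
    calc _ = U * diagonal (fun i => ((s * hH.eigenvalues i + c : ℝ) : ℂ)) * (star U * U) *
        diagonal (fun i => ((1 / (s * hH.eigenvalues i + c) : ℝ) : ℂ)) * star U := by
          simp only [Matrix.mul_assoc]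
      _ = 1 := by
          rw [h2, Matrix.mul_one, Matrix.mul_assoc U, d, Matrix.mul_one, h1]
  rw [inv, Matrix.trace_mul_comm, ← Matrix.mul_assoc, h2, Matrix.one_mul, Matrix.trace_diagonal]
  push_cast
  rfl

open ComplexOrder in
theorem aux_psd_s18 {M N : ℕ} (A : Matrix (Fin M) (Fin N) ℂ) :
    ∃ hH : (Aᴴ * A).IsHermitian, ∀ i, 0 ≤ hH.eigenvalues i := by
  have hps : (Aᴴ * A).PosSemidef := posSemidef_conjTranspose_mul_self A
  exact ⟨hps.isHermitian, fun i => hps.eigenvalues_nonneg i⟩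

open Filter Topology in
theorem aux_lim {N : ℕ} (hN : 0 < N) (l : Fin N → ℝ) (hl : ∀ i, 0 ≤ l i) (s : ℝ) (hs : 0 < s) :
    Tendsto (fun w : ℝ => 1 / ((1 / (N : ℝ)) * ∑ i, 1 / (s * l i + w⁻¹)) - 1 / w)
      (𝓝[>] 0) (𝓝 (s * ((1 / (N : ℝ)) * ∑ i, l i))) := by
  have hN' : (0 : ℝ) < N := by exact_mod_cast hN
  have key : Tendsto (fun w : ℝ => ((1 / (N : ℝ)) * ∑ i, s * l i / (1 + s * l i * w)) /
      ((1 / (N : ℝ)) * ∑ i, 1 / (1 + s * l i * w))) (𝓝[>] 0)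
      (𝓝 (((1 / (N : ℝ)) * ∑ i, s * l i / (1 + s * l i * 0)) /
      ((1 / (N : ℝ)) * ∑ i, 1 / (1 + s * l i * 0)))) := by
    have b : ContinuousAt (fun w : ℝ => ((1 / (N : ℝ)) * ∑ i, s * l i / (1 + s * l i * w)) /
      ((1 / (N : ℝ)) * ∑ i, 1 / (1 + s * l i * w))) 0 := by
      refine ContinuousAt.div ?_ ?_ ?_
      · refine continuousAt_const.mul (tendsto_finsetSum _ fun i _ => ?_)
        exact ContinuousAt.div (by fun_prop) (by fun_prop) (by simp)
      · refine continuousAt_const.mul (tendsto_finsetSum _ fun i _ => ?_)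
        exact ContinuousAt.div (by fun_prop) (by fun_prop) (by simp)
      · simp [hN'.ne']
    exact b.tendsto.mono_left nhdsWithin_le_nhds
  have hv : ((1 / (N : ℝ)) * ∑ i, s * l i / (1 + s * l i * 0)) /
      ((1 / (N : ℝ)) * ∑ i, 1 / (1 + s * l i * 0)) = s * ((1 / (N : ℝ)) * ∑ i, l i) := by
    simp [hN'.ne', ← Finset.mul_sum]
    ring
  rw [hv] at key
  refine key.congr' ?_
  filter_upwards [self_mem_nhdsWithin] with w hw
  have hw : 0 < w := hw
  have hp : ∀ i, 0 < 1 + s * l i * w := fun i => by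
    have := mul_nonneg (mul_nonneg hs.le (hl i)) hw.le
    positivity
  have e1 : ∑ i, 1 / (s * l i + w⁻¹) = w * ∑ i, 1 / (1 + s * l i * w) := by
    rw [Finset.mul_sum]
    refine Finset.sum_congr rfl fun i _ => ?_
    have : s * l i + w⁻¹ = (1 + s * l i * w) / w := by field_simp; ring
    rw [this]
    have := (hp i).ne'
    field_simp
  have e2 : w * ∑ i, s * l i / (1 + s * l i * w) = N - ∑ i, 1 / (1 + s * l i * w) := by
    have : (N : ℝ) = ∑ i : Fin N, (1 : ℝ) := by simp
    rw [this, Finset.mul_sum, ← Finset.sum_sub_distrib]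
    refine Finset.sum_congr rfl fun i _ => ?_
    have := (hp i).ne'
    rw [eq_sub_iff_add_eq, ← mul_div_assoc, ← add_div, div_eq_one_iff_eq this]
    ring
  have hS : 0 < ∑ i, 1 / (1 + s * l i * w) :=
    Finset.sum_pos (fun i _ => one_div_pos.mpr (hp i)) ⟨⟨0, hN⟩, Finset.mem_univ _⟩
  rw [e1]
  generalize (∑ i, 1 / (1 + s * l i * w)) = S at *
  generalize (∑ i, s * l i / (1 + s * l i * w)) = T at *
  field_simp
  linarith

/-- Boundary value of the OAMP linear transfer function: with
`η(v) = 1/v − 1/γ̂⁻¹(v)`, one has `η(v) → snr·(1/N)·tr(AᴴA)` as `v → 0⁺`; in particular,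
under the normalization `(1/N)·tr(AᴴA) = 1`, `η(v) → snr`. -/
theorem eta_limit_at_zero
    (M N : ℕ) (hN : 0 < N) (A : Matrix (Fin M) (Fin N) ℂ) (hA : A ≠ 0)
    (snr : ℝ) (hsnr : 0 < snr)
    (γhat : ℝ → ℝ)
    (hγhat : γhat = fun v : ℝ =>
      (1 / (N : ℝ)) *
        ((((snr : ℂ) • (Aᴴ * A) + ((v⁻¹ : ℝ) : ℂ) • (1 : Matrix (Fin N) (Fin N) ℂ))⁻¹).trace).re)
    (hγ_mono : StrictMonoOn γhat (Set.Ioi (0 : ℝ)))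
    (hγ_cont : ContinuousOn γhat (Set.Ioi (0 : ℝ)))
    (hγ_range : ∃ ε > (0 : ℝ), ∀ u ∈ Set.Ioo (0 : ℝ) ε, ∃ w > (0 : ℝ), γhat w = u)
    (γinv : ℝ → ℝ)
    (hγinv_left : ∀ w > (0 : ℝ), γinv (γhat w) = w)
    (η : ℝ → ℝ)
    (hη : η = fun v : ℝ => 1 / v - 1 / γinv v) :
    Filter.Tendsto η (nhdsWithin 0 (Set.Ioi (0 : ℝ)))
      (nhds (snr * ((1 / (N : ℝ)) * ((Aᴴ * A).trace).re)))
    ∧ ((1 / (N : ℝ)) * ((Aᴴ * A).trace).re = 1 →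
        Filter.Tendsto η (nhdsWithin 0 (Set.Ioi (0 : ℝ))) (nhds snr)) := by
  obtain ⟨hH, hl⟩ := aux_psd_s18 A
  have hN' : (0 : ℝ) < N := by exact_mod_cast hN
  have hform : ∀ w > (0 : ℝ), γhat w
      = (1 / (N : ℝ)) * ∑ i, 1 / (snr * hH.eigenvalues i + w⁻¹) := by
    intro w hw
    rw [hγhat]
    simp only
    rw [aux_trace_s18 _ hH hl snr w⁻¹ hsnr (inv_pos.mpr hw), Complex.ofReal_re]
  have htr : ((Aᴴ * A).trace).re = ∑ i, hH.eigenvalues i := by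
    rw [hH.trace_eq_sum_eigenvalues]
    simp
  have hpos : ∀ w > (0 : ℝ), 0 < γhat w := by
    intro w hw
    rw [hform w hw]
    refine mul_pos (by positivity) (Finset.sum_pos (fun i _ => one_div_pos.mpr ?_)
      ⟨⟨0, hN⟩, Finset.mem_univ _⟩)
    have := mul_nonneg hsnr.le (hl i)
    positivity
  obtain ⟨ε, hε, hr⟩ := hγ_range
  have hinv : ∀ u ∈ Set.Ioo (0 : ℝ) ε, 0 < γinv u ∧ γhat (γinv u) = u := by
    intro u hu
    obtain ⟨w, hw, rfl⟩ := hr u hu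
    rw [hγinv_left w hw]
    exact ⟨hw, rfl⟩
  have hev : ∀ᶠ u in nhdsWithin 0 (Set.Ioi (0 : ℝ)), u ∈ Set.Ioo (0 : ℝ) ε :=
    Ioo_mem_nhdsGT hε
  have hlim : Filter.Tendsto γinv (nhdsWithin 0 (Set.Ioi (0 : ℝ)))
      (nhdsWithin 0 (Set.Ioi (0 : ℝ))) := by
    refine tendsto_nhdsWithin_iff.mpr ⟨?_, hev.mono fun u hu => (hinv u hu).1⟩
    refine tendsto_order.mpr ⟨fun a ha => hev.mono fun u hu => ha.trans (hinv u hu).1, ?_⟩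
    intro δ hδ
    filter_upwards [hev, Ioo_mem_nhdsGT (hpos δ hδ)] with u hu hu2
    obtain ⟨h1, h2⟩ := hinv u hu
    refine (hγ_mono.lt_iff_lt h1 hδ).mp ?_
    rw [h2]
    exact hu2.2
  have main : Filter.Tendsto η (nhdsWithin 0 (Set.Ioi (0 : ℝ)))
      (nhds (snr * ((1 / (N : ℝ)) * ((Aᴴ * A).trace).re))) := by
    rw [htr]
    refine ((aux_lim hN _ hl snr hsnr).comp hlim).congr' ?_
    filter_upwards [hev] with u hu
    obtain ⟨h1, h2⟩ := hinv u hu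
    simp only [Function.comp]
    rw [← hform _ h1, h2, hη]
  refine ⟨main, fun h => ?_⟩
  rw [h, mul_one] at main
  exact main
end
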